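/- arXiv:0905.1508 — 3 statements merged into one kernel-verified Lean document; each statement's English description precedes it below -/
import Mathlib

section
/- Let R be an algebraic curvature tensor on ℝⁿ (n ≥ 4) with nonnegative sectional curvature and λ-pinched flag curvature with λ ≥ 1/4. Then R has nonnegative complex sectional curvature: for all U, V ∈ ℂⁿ = ℝⁿ ⊗ ℂ, R(U, V, Ū, V̄) ≥ 0, where R is extended complex-multilinearly. -/
open scoped RealInnerProductSpace

section core
variable {E : Type*} [NormedAddCommGroup E] [InnerProductSpace ℝ E]

/-- off-diagonal bound for the Jacobi operator -/
lemma offdiag (R : E →ₗ[ℝ] E →ₗ[ℝ] E →ₗ[ℝ] E →ₗ[ℝ] ℝ)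
    (hpair : ∀ X Y Z W, R X Y Z W = R Z W X Y)
    (hsec : ∀ X Y, 0 ≤ R X Y X Y)
    (hflag : ∀ e X Y : E, ⟪e, X⟫ = 0 → ⟪e, Y⟫ = 0 → ‖X‖ = ‖Y‖ → R e Y e Y ≤ 4 * R e X e X)
    (e Y W : E) (h1 : ⟪e, Y⟫ = 0) (h2 : ⟪e, W⟫ = 0) (h3 : ⟪Y, W⟫ = 0) (hn : ‖Y‖ = ‖W‖) :
    (R e Y e W) ^ 2 ≤ 9 / 25 * (R e Y e Y * R e W e W) := by
  have key : ∀ c : ℝ, 0 ≤ (R e Y e Y - R e W e W / 4) * (c * c) + (5 / 2 * R e Y e W) * c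
      + (R e W e W - R e Y e Y / 4) := by
    intro c
    have h3' : ⟪W, Y⟫ = 0 := by rw [real_inner_comm]; exact h3
    have hnorm : ‖c • Y + W‖ = ‖c • W - Y‖ := by
      rw [← sq_eq_sq₀ (norm_nonneg _) (norm_nonneg _), norm_add_sq_real, norm_sub_sq_real]
      simp only [norm_smul, inner_smul_left, h3, h3', mul_pow, hn]
      simp
    have := hflag e (c • Y + W) (c • W - Y) (by simp [inner_add_right, inner_smul_right, h1, h2])
      (by simp [inner_sub_right, inner_smul_right, h1, h2]) hnorm
    simp only [map_add, map_sub, map_smul, LinearMap.add_apply, LinearMap.sub_apply,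
      LinearMap.smul_apply, smul_eq_mul] at this
    rw [hpair e W e Y] at this
    linarith
  have := discrim_le_zero key
  unfold discrim at this
  nlinarith [sq_nonneg (R e Y e Y - R e W e W)]

lemma offdiag' (R : E →ₗ[ℝ] E →ₗ[ℝ] E →ₗ[ℝ] E →ₗ[ℝ] ℝ)
    (hpair : ∀ X Y Z W, R X Y Z W = R Z W X Y)
    (hsec : ∀ X Y, 0 ≤ R X Y X Y)
    (hflag : ∀ e X Y : E, ⟪e, X⟫ = 0 → ⟪e, Y⟫ = 0 → ‖X‖ = ‖Y‖ → R e Y e Y ≤ 4 * R e X e X)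
    (e Y W : E) (h1 : ⟪e, Y⟫ = 0) (h2 : ⟪e, W⟫ = 0) (h3 : ⟪Y, W⟫ = 0) (hn : ‖Y‖ = ‖W‖)
    (y w : ℝ) :
    |R e (y • Y) e (w • W)| ≤
      3 / 10 * (R e (y • Y) e (y • Y) + R e (w • W) e (w • W)) := by
  have h := offdiag R hpair hsec hflag e Y W h1 h2 h3 hn
  have h0 := hsec e (y • Y)
  have h0' := hsec e (w • W)
  simp only [map_smul, LinearMap.smul_apply, smul_eq_mul] at h0 h0' ⊢
  apply abs_le_of_sq_le_sq _ (by positivity)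
  have := mul_le_mul_of_nonneg_left h (sq_nonneg (y * w))
  nlinarith [sq_nonneg (y * (y * R e Y e Y) - w * (w * R e W e W))]

/-- mixed curvature bound -/
lemma mixed (R : E →ₗ[ℝ] E →ₗ[ℝ] E →ₗ[ℝ] E →ₗ[ℝ] ℝ)
    (hanti : ∀ X Y Z W, R X Y Z W = - R Y X Z W)
    (hpair : ∀ X Y Z W, R X Y Z W = R Z W X Y)
    (hsec : ∀ X Y, 0 ≤ R X Y X Y)
    (hflag : ∀ e X Y : E, ⟪e, X⟫ = 0 → ⟪e, Y⟫ = 0 → ‖X‖ = ‖Y‖ → R e Y e Y ≤ 4 * R e X e X)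
    (X Y Z W : E) (hXY : ⟪X, Y⟫ = 0) (hXW : ⟪X, W⟫ = 0) (hZY : ⟪Z, Y⟫ = 0)
    (hZW : ⟪Z, W⟫ = 0) (hYW : ⟪Y, W⟫ = 0) (hn : ‖Y‖ = ‖W‖) (x y z w : ℝ) :
    x * y * z * w * (R X Y Z W - R Y Z X W) ≤
      3 / 10 * (x ^ 2 * y ^ 2 * R X Y X Y + z ^ 2 * y ^ 2 * R Z Y Z Y
        + x ^ 2 * w ^ 2 * R X W X W + z ^ 2 * w ^ 2 * R Z W Z W) := by
  have h1 := (abs_le.1 (offdiag' R hpair hsec hflag (x • X + z • Z) Y W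
    (by simp [inner_add_left, inner_smul_left, hXY, hZY])
    (by simp [inner_add_left, inner_smul_left, hXW, hZW]) hYW hn y w)).2
  have h2 := (abs_le.1 (offdiag' R hpair hsec hflag (x • X + (-z) • Z) Y W
    (by simp [inner_add_left, inner_smul_left, hXY, hZY])
    (by simp [inner_add_left, inner_smul_left, hXW, hZW]) hYW hn y w)).1
  simp only [map_add, map_sub, map_smul, LinearMap.add_apply, LinearMap.sub_apply,
    LinearMap.smul_apply, smul_eq_mul] at h1 h2
  rw [hanti Y Z X W]
  nlinarith [h1, h2]

lemma core_unit (R : E →ₗ[ℝ] E →ₗ[ℝ] E →ₗ[ℝ] E →ₗ[ℝ] ℝ)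
    (hanti : ∀ X Y Z W, R X Y Z W = - R Y X Z W)
    (hpair : ∀ X Y Z W, R X Y Z W = R Z W X Y)
    (hbianchi : ∀ X Y Z W, R X Y Z W + R Y Z X W + R Z X Y W = 0)
    (hsec : ∀ X Y, 0 ≤ R X Y X Y)
    (hflag : ∀ e X Y : E, ⟪e, X⟫ = 0 → ⟪e, Y⟫ = 0 → ‖X‖ = ‖Y‖ → R e Y e Y ≤ 4 * R e X e X)
    (X Y Z W : E) (hXY : ⟪X, Y⟫ = 0) (hXZ : ⟪X, Z⟫ = 0) (hXW : ⟪X, W⟫ = 0) (hYZ : ⟪Y, Z⟫ = 0)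
    (hYW : ⟪Y, W⟫ = 0) (hZW : ⟪Z, W⟫ = 0)
    (nX : ‖X‖ = 1) (nY : ‖Y‖ = 1) (nZ : ‖Z‖ = 1) (nW : ‖W‖ = 1) (x y z w : ℝ) :
    2 * (x * y * z * w * R X Y Z W) ≤ x ^ 2 * z ^ 2 * R X Z X Z + y ^ 2 * w ^ 2 * R Y W Y W
      + x ^ 2 * w ^ 2 * R X W X W + y ^ 2 * z ^ 2 * R Y Z Y Z := by
  have c {A B : E} (h : ⟪A, B⟫ = 0) : ⟪B, A⟫ = 0 := by rw [real_inner_comm]; exact h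
  have anti2 : ∀ X Y Z W, R X Y Z W = - R X Y W Z := fun X Y Z W => by
    rw [hpair, hanti, hpair]
  have sw : ∀ A B, R B A B A = R A B A B := fun A B => by
    rw [hanti, anti2, neg_neg]
  have m1 := mixed R hanti hpair hsec hflag X Y Z W hXY hXW (c hYZ) hZW hYW (by rw [nY, nW])
    x z y w
  have m2 := mixed R hanti hpair hsec hflag X Y W Z hXY hXZ (c hYW) (c hZW) hYZ (by rw [nY, nZ])
    z y (-w) x
  have f1 := hflag X Z Y hXZ hXY (by rw [nZ, nY])
  have f2 := hflag W Y Z (c hYW) (c hZW) (by rw [nZ, nY])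
  have f3 := hflag Y Z X hYZ (c hXY) (by rw [nZ, nX])
  have f4 := hflag W X Z (c hXW) (c hZW) (by rw [nZ, nX])
  rw [sw Y W, sw Z W] at f2
  rw [sw X Y] at f3
  rw [sw X W, sw Z W] at f4
  rw [sw Y Z] at m1
  rw [sw Y W, sw Z W, anti2 X Y W Z] at m2
  have hb : R Y W X Z = R Z X Y W * (-1) := by
    rw [hpair, hanti]; ring
  rw [hb] at m2
  have hc : R Z X Y W = - R X Y Z W - R Y Z X W := by linarith [hbianchi X Y Z W]
  rw [hc] at m2
  have g1 := mul_le_mul_of_nonneg_left f1 (by positivity : 0 ≤ x ^ 2 * z ^ 2)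
  have g2 := mul_le_mul_of_nonneg_left f2 (by positivity : 0 ≤ y ^ 2 * w ^ 2)
  have g3 := mul_le_mul_of_nonneg_left f3 (by positivity : 0 ≤ y ^ 2 * z ^ 2)
  have g4 := mul_le_mul_of_nonneg_left f4 (by positivity : 0 ≤ x ^ 2 * w ^ 2)
  linarith

lemma core (R : E →ₗ[ℝ] E →ₗ[ℝ] E →ₗ[ℝ] E →ₗ[ℝ] ℝ)
    (hanti : ∀ X Y Z W, R X Y Z W = - R Y X Z W)
    (hpair : ∀ X Y Z W, R X Y Z W = R Z W X Y)
    (hbianchi : ∀ X Y Z W, R X Y Z W + R Y Z X W + R Z X Y W = 0)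
    (hsec : ∀ X Y, 0 ≤ R X Y X Y)
    (hflag : ∀ e X Y : E, ⟪e, X⟫ = 0 → ⟪e, Y⟫ = 0 → ‖X‖ = ‖Y‖ → R e Y e Y ≤ 4 * R e X e X)
    (X Y Z W : E) (hXY : ⟪X, Y⟫ = 0) (hXZ : ⟪X, Z⟫ = 0) (hXW : ⟪X, W⟫ = 0) (hYZ : ⟪Y, Z⟫ = 0)
    (hYW : ⟪Y, W⟫ = 0) (hZW : ⟪Z, W⟫ = 0) :
    2 * R X Y Z W ≤ R X Z X Z + R Y W Y W + R X W X W + R Y Z Y Z := by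
  by_cases h0 : R X Y Z W = 0
  · rw [h0]
    linarith [hsec X Z, hsec Y W, hsec X W, hsec Y Z]
  have X0 : X ≠ 0 := by rintro rfl; simp at h0
  have Y0 : Y ≠ 0 := by rintro rfl; simp at h0
  have Z0 : Z ≠ 0 := by rintro rfl; simp at h0
  have W0 : W ≠ 0 := by rintro rfl; simp at h0
  have e (A : E) (h : A ≠ 0) : ∃ (a : ℝ) (B : E), A = a • B ∧ ‖B‖ = 1 ∧ a ≠ 0 := by
    refine ⟨‖A‖, ‖A‖⁻¹ • A, ?_, ?_, by simpa using h⟩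
    · rw [smul_smul, mul_inv_cancel₀ (by simpa using h), one_smul]
    · rw [norm_smul, norm_inv, norm_norm, inv_mul_cancel₀ (by simpa using h)]
  obtain ⟨x, X, rfl, nX, x0⟩ := e X X0
  obtain ⟨y, Y, rfl, nY, y0⟩ := e Y Y0
  obtain ⟨z, Z, rfl, nZ, z0⟩ := e Z Z0
  obtain ⟨w, W, rfl, nW, w0⟩ := e W W0
  simp only [inner_smul_left, inner_smul_right, mul_eq_zero, x0, y0, z0, w0, false_or,
    conj_trivial] at hXY hXZ hXW hYZ hYW hZW
  have := core_unit R hanti hpair hbianchi hsec hflag X Y Z W hXY hXZ hXW hYZ hYW hZW nX nY nZ nW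
    x y z w
  simp only [map_smul, LinearMap.smul_apply, smul_eq_mul]
  linarith

end core

/-- Takagi-type normal form for a complex 2-plane. -/
lemma takagi {n : ℕ} (U V : EuclideanSpace ℂ (Fin n)) (h : U ≠ 0 ∨ V ≠ 0) :
    ∃ a b c d : ℂ, a * d - b * c ≠ 0 ∧
      ∃ u v : EuclideanSpace ℂ (Fin n), u = a • U + b • V ∧ v = c • U + d • V ∧
      inner ℂ u v = 0 ∧ ∑ i, u i * v i = 0 ∧ (∑ i, u i * u i).im = 0 ∧ (∑ i, v i * v i).im = 0 := by
  set B : EuclideanSpace ℂ (Fin n) → EuclideanSpace ℂ (Fin n) → ℂ :=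
    fun u v => ∑ i, u i * v i with hB
  have Badd : ∀ u v w, B u (v + w) = B u v + B u w := by
    intro u v w; simp [hB, mul_add, Finset.sum_add_distrib]
  have Bsmul : ∀ (c : ℂ) u v, B u (c • v) = c * B u v := by
    intro c u v; simp only [hB, Finset.mul_sum, PiLp.smul_apply, smul_eq_mul]
    exact Finset.sum_congr rfl fun i _ => by ring
  have Bcomm : ∀ u v, B u v = B v u := fun u v => by simp only [hB, mul_comm]
  have Bcont : Continuous fun u => (B u u).re := by
    simp only [hB]; fun_prop
  set σ : Submodule ℂ (EuclideanSpace ℂ (Fin n)) := Submodule.span ℂ {U, V} with hσ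
  have hU : U ∈ σ := Submodule.subset_span (by simp)
  have hV : V ∈ σ := Submodule.subset_span (by simp)
  have hcpt : IsCompact (Metric.sphere (0 : EuclideanSpace ℂ (Fin n)) 1 ∩ (σ : Set _)) :=
    (isCompact_sphere 0 1).inter_right σ.closed_of_finiteDimensional
  have unit : ∀ A ∈ σ, A ≠ 0 →
      ((‖A‖⁻¹ : ℝ) : ℂ) • A ∈ (Metric.sphere (0 : EuclideanSpace ℂ (Fin n)) 1 ∩ (σ : Set _)) := by
    intro A hA h0
    refine ⟨?_, σ.smul_mem _ hA⟩
    rw [mem_sphere_zero_iff_norm, norm_smul, Complex.norm_real, norm_inv, norm_norm,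
      inv_mul_cancel₀ (by simpa using h0)]
  have hne : (Metric.sphere (0 : EuclideanSpace ℂ (Fin n)) 1 ∩ (σ : Set _)).Nonempty := by
    rcases h with h | h
    · exact ⟨_, unit U hU h⟩
    · exact ⟨_, unit V hV h⟩
  obtain ⟨u, ⟨hu1, huσ⟩, hmax⟩ := hcpt.exists_isMaxOn hne Bcont.continuousOn
  rw [mem_sphere_zero_iff_norm] at hu1
  set m := (B u u).re with hm
  have hle : ∀ w ∈ σ, (B w w).re ≤ m * ‖w‖ ^ 2 := by
    intro w hw
    by_cases h0 : w = 0
    · subst h0; simp [hB]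
    have h1 := hmax (unit w hw h0)
    simp only [Set.mem_ofPred_eq] at h1
    rw [Bsmul, Bcomm, Bsmul, Complex.re_ofReal_mul, Complex.re_ofReal_mul] at h1
    have hp : 0 < ‖w‖ := norm_pos_iff.2 h0
    rw [← mul_assoc, ← mul_inv, inv_mul_le_iff₀ (by positivity)] at h1
    linarith
  have hfirst : ∀ v ∈ σ, (B u v).re = m * (inner ℂ u v).re := by
    intro v hv
    set D := (B u v).re - m * (inner ℂ u v).re with hD
    have key : ∀ t : ℝ, 0 ≤ (m * ‖v‖ ^ 2 - (B v v).re) * (t * t) + (-2 * D) * t + 0 := by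
      intro t
      have h1 := hle (u + (t : ℂ) • v) (σ.add_mem huσ (σ.smul_mem _ hv))
      have e1 : (B (u + (t : ℂ) • v) (u + (t : ℂ) • v)).re
          = m + 2 * t * (B u v).re + t * t * (B v v).re := by
        rw [Badd, Bsmul, Bcomm _ u, Bcomm _ v, Badd, Badd, Bsmul, Bsmul, Bcomm v u]
        simp only [Complex.add_re, Complex.re_ofReal_mul]
        rw [← hm]; ring
      have e2 : ‖u + (t : ℂ) • v‖ ^ 2 = 1 + 2 * t * (inner ℂ u v).re + t * t * ‖v‖ ^ 2 := by
        rw [@norm_add_sq ℂ, hu1, inner_smul_right, norm_smul, Complex.norm_real, mul_pow,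
          Real.norm_eq_abs, sq_abs]
        simp only [RCLike.re_eq_complex_re, Complex.re_ofReal_mul]
        ring
      rw [e1, e2] at h1
      rw [hD]; linarith
    have := discrim_le_zero key
    unfold discrim at this
    have : D = 0 := by nlinarith
    linarith
  have himu : (B u u).im = 0 := by
    have := hfirst (Complex.I • u) (σ.smul_mem _ huσ)
    rw [Bsmul, inner_smul_right, inner_self_eq_norm_sq_to_K, hu1] at this
    simpa using this
  have horth : ∀ v ∈ σ, inner ℂ u v = 0 → B u v = 0 := by
    intro v hv h0
    have h1 := hfirst v hv
    have h2 := hfirst (Complex.I • v) (σ.smul_mem _ hv)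
    rw [Bsmul, inner_smul_right, h0] at h2
    rw [h0] at h1
    apply Complex.ext
    · simpa using h1
    · simpa using h2
  have hphase : ∀ v, ∃ c : ℂ, c ≠ 0 ∧ (B (c • v) (c • v)).im = 0 := by
    intro v
    by_cases h0 : B v v = 0
    · exact ⟨1, one_ne_zero, by simp [h0]⟩
    obtain ⟨c, hc⟩ := IsAlgClosed.exists_pow_nat_eq (star (B v v)) (n := 2) (by norm_num)
    refine ⟨c, ?_, ?_⟩
    · rintro rfl
      rw [zero_pow two_ne_zero] at hc
      exact h0 (star_eq_zero.1 hc.symm)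
    · rw [Bsmul, Bcomm, Bsmul, ← mul_assoc, ← sq, hc]
      simp; ring
  have hproj : ∀ A, inner ℂ u (A - (inner ℂ u A) • u) = 0 := by
    intro A
    rw [inner_sub_right, inner_smul_right, inner_self_eq_norm_sq_to_K, hu1]; simp
  obtain ⟨a, b, hab⟩ := Submodule.mem_span_pair.1 huσ
  have hab0 : a ≠ 0 ∨ b ≠ 0 := by
    by_contra! hh
    rw [hh.1, hh.2] at hab
    rw [← hab] at hu1
    simp at hu1
  rcases hab0 with ha | hb
  · set k := inner ℂ u V with hk
    obtain ⟨c, hc0, hc⟩ := hphase (V - k • u)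
    have hi : inner ℂ u (c • (V - k • u)) = 0 := by rw [inner_smul_right, hproj, mul_zero]
    refine ⟨a, b, -(c * k * a), c * (1 - k * b), ?_, u, c • (V - k • u), hab.symm, ?_, hi,
      horth _ (σ.smul_mem _ (σ.sub_mem hV (σ.smul_mem _ huσ))) hi, himu, hc⟩
    · have : a * (c * (1 - k * b)) - b * (-(c * k * a)) = a * c := by ring
      rw [this]; exact mul_ne_zero ha hc0
    · rw [← hab]; module
  · set k := inner ℂ u U with hk
    obtain ⟨c, hc0, hc⟩ := hphase (U - k • u)
    have hi : inner ℂ u (c • (U - k • u)) = 0 := by rw [inner_smul_right, hproj, mul_zero]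
    refine ⟨a, b, c * (1 - k * a), -(c * k * b), ?_, u, c • (U - k • u), hab.symm, ?_, hi,
      horth _ (σ.smul_mem _ (σ.sub_mem hU (σ.smul_mem _ huσ))) hi, himu, hc⟩
    · have : a * (-(c * k * b)) - b * (c * (1 - k * a)) = -(b * c) := by ring
      rw [this]; exact neg_ne_zero.2 (mul_ne_zero hb hc0)
    · rw [← hab]; module

/-- Theorem 1.1 of Ni–Wilking (algebraic form): an algebraic curvature tensor
on `ℝⁿ` (`n ≥ 4`) with nonnegative sectional curvature and `λ`-pinched flag
curvature, `λ ≥ 1/4`, has nonnegative complex sectional curvature: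
`R(U, V, Ū, V̄) ≥ 0` (in particular it is real) for all `U, V ∈ ℂⁿ`, where `R`
is extended complex-multilinearly. -/
theorem stmt_6 (n : ℕ) (hn : 4 ≤ n)
    (R : EuclideanSpace ℝ (Fin n) →ₗ[ℝ] EuclideanSpace ℝ (Fin n) →ₗ[ℝ]
      EuclideanSpace ℝ (Fin n) →ₗ[ℝ] EuclideanSpace ℝ (Fin n) →ₗ[ℝ] ℝ)
    (hanti : ∀ X Y Z W, R X Y Z W = - R Y X Z W)
    (hpair : ∀ X Y Z W, R X Y Z W = R Z W X Y)
    (hbianchi : ∀ X Y Z W, R X Y Z W + R Y Z X W + R Z X Y W = 0)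
    (hsec : ∀ X Y, 0 ≤ R X Y X Y)
    (lam : ℝ) (hlam : 1 / 4 ≤ lam)
    (hflag : ∀ e X Y : EuclideanSpace ℝ (Fin n), e ≠ 0 → ⟪e, X⟫ = 0 → ⟪e, Y⟫ = 0 →
      ‖X‖ = ‖Y‖ → lam * R e Y e Y ≤ R e X e X)
    -- the complex-multilinear extension of `R` to `ℂⁿ`, in coordinates
    (Rc : (Fin n → ℂ) → (Fin n → ℂ) → (Fin n → ℂ) → (Fin n → ℂ) → ℂ)
    (hRc : ∀ U V S T, Rc U V S T =
      ∑ i, ∑ j, ∑ k, ∑ l, U i * V j * S k * T l *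
        (R (EuclideanSpace.single i 1) (EuclideanSpace.single j 1)
          (EuclideanSpace.single k 1) (EuclideanSpace.single l 1) : ℂ))
    (U V : Fin n → ℂ) :
    0 ≤ (Rc U V (star U) (star V)).re ∧ (Rc U V (star U) (star V)).im = 0 := by
  have hflag4 : ∀ e X Y : EuclideanSpace ℝ (Fin n), ⟪e, X⟫ = 0 → ⟪e, Y⟫ = 0 → ‖X‖ = ‖Y‖ →
      R e Y e Y ≤ 4 * R e X e X := by
    intro e X Y h1 h2 h3
    by_cases he : e = 0
    · subst he; simp
    · have := hflag e X Y he h1 h2 h3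
      nlinarith [hsec e Y]
  have anti2 : ∀ X Y Z W, R X Y Z W = - R X Y W Z := fun X Y Z W => by
    rw [hpair, hanti, hpair]
  -- multilinearity of Rc
  have add1 : ∀ A B C D F, Rc (A + B) C D F = Rc A C D F + Rc B C D F := by
    intro A B C D F
    simp only [hRc, Pi.add_apply, add_mul, Finset.sum_add_distrib]
  have smul1 : ∀ (a : ℂ) A C D F, Rc (a • A) C D F = a * Rc A C D F := by
    intro a A C D F
    simp only [hRc, Pi.smul_apply, smul_eq_mul, Finset.mul_sum, mul_assoc]
  have cpair : ∀ A B C D, Rc A B C D = Rc C D A B := by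
    intro A B C D
    rw [hRc, hRc]
    simp_rw [← Finset.sum_product', Finset.univ_product_univ]
    refine Fintype.sum_bijective (fun p : Fin n × Fin n × Fin n × Fin n =>
      (p.2.2.1, p.2.2.2, p.1, p.2.1)) ⟨fun p q h => by
        simp only [Prod.mk.injEq] at h; ext <;> simp [h], fun p =>
        ⟨(p.2.2.1, p.2.2.2, p.1, p.2.1), rfl⟩⟩ _ _ fun p => ?_
    rw [hpair]
    ring
  have canti : ∀ A B C D, Rc A B C D = - Rc B A C D := by
    intro A B C D
    rw [hRc, hRc, Finset.sum_comm]
    simp_rw [← Finset.sum_neg_distrib]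
    refine Finset.sum_congr rfl fun i _ => Finset.sum_congr rfl fun j _ =>
      Finset.sum_congr rfl fun k _ => Finset.sum_congr rfl fun l _ => ?_
    rw [hanti]
    push_cast; ring
  have add2 : ∀ A B C D F, Rc A (B + C) D F = Rc A B D F + Rc A C D F := by
    intro A B C D F
    rw [canti, add1, canti B, canti C]; ring
  have smul2 : ∀ (a : ℂ) A C D F, Rc A (a • C) D F = a * Rc A C D F := by
    intro a A C D F
    rw [canti, smul1, canti C]; ring
  have add3 : ∀ A B C D F, Rc A B (C + D) F = Rc A B C F + Rc A B D F := by
    intro A B C D F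
    rw [cpair, add1, cpair C, cpair D]
  have smul3 : ∀ (a : ℂ) A C D F, Rc A C (a • D) F = a * Rc A C D F := by
    intro a A C D F
    rw [cpair, smul1, cpair D]
  have add4 : ∀ A B C D F, Rc A B C (D + F) = Rc A B C D + Rc A B C F := by
    intro A B C D F
    rw [cpair, add2, cpair C, cpair C]
  have smul4 : ∀ (a : ℂ) A C D F, Rc A C D (a • F) = a * Rc A C D F := by
    intro a A C D F
    rw [cpair, smul2, cpair D]
  have czero : ∀ A C D, Rc A A C D = 0 := by
    intro A C D
    have := canti A A C D
    linear_combination this / 2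
  have czero' : ∀ A C D, Rc C D A A = 0 := by
    intro A C D
    rw [cpair, czero]
  have canti2 : ∀ A B C D, Rc A B C D = - Rc A B D C := fun A B C D => by
    rw [cpair, canti, cpair]
  have hdet : ∀ a b c d : ℂ, Rc (a • U + b • V) (c • U + d • V) (star (a • U + b • V))
      (star (c • U + d • V)) = (Complex.normSq (a * d - b * c) : ℂ) * Rc U V (star U) (star V) := by
    intro a b c d
    simp only [star_add, star_smul, add1, add2, add3, add4, smul1, smul2, smul3, smul4, czero,
      czero']
    rw [canti V U (star U) (star V), canti V U (star V) (star U), canti2 U V (star V) (star U)]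
    rw [Complex.normSq_eq_conj_mul_self]
    simp only [map_sub, map_mul, starRingEnd_apply]
    ring
  -- values on real vectors
  have hreal : ∀ X Y Z W : EuclideanSpace ℝ (Fin n),
      Rc (fun i => (X i : ℂ)) (fun i => (Y i : ℂ)) (fun i => (Z i : ℂ)) (fun i => (W i : ℂ))
        = (R X Y Z W : ℂ) := by
    intro X Y Z W
    have ex : ∀ A : EuclideanSpace ℝ (Fin n), A = ∑ i, A i • EuclideanSpace.single i (1 : ℝ) := by
      intro A
      ext j
      simp [Pi.single_apply]
    rw [hRc]
    have s1 : R X Y Z W = ∑ i, X i * R (EuclideanSpace.single i 1) Y Z W := by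
      conv_lhs => rw [ex X]
      simp only [map_sum, map_smul, LinearMap.sum_apply, LinearMap.smul_apply, smul_eq_mul]
    have s2 : ∀ A, R A Y Z W = ∑ i, Y i * R A (EuclideanSpace.single i 1) Z W := by
      intro A
      conv_lhs => rw [ex Y]
      simp only [map_sum, map_smul, LinearMap.sum_apply, LinearMap.smul_apply, smul_eq_mul]
    have s3 : ∀ A B, R A B Z W = ∑ i, Z i * R A B (EuclideanSpace.single i 1) W := by
      intro A B
      conv_lhs => rw [ex Z]
      simp only [map_sum, map_smul, LinearMap.sum_apply, LinearMap.smul_apply, smul_eq_mul]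
    have s4 : ∀ A B C, R A B C W = ∑ i, W i * R A B C (EuclideanSpace.single i 1) := by
      intro A B C
      conv_lhs => rw [ex W]
      simp only [map_sum, map_smul, smul_eq_mul]
    rw [s1, Complex.ofReal_sum]
    refine Finset.sum_congr rfl fun i _ => ?_
    rw [s2, Finset.mul_sum, Complex.ofReal_sum]
    refine Finset.sum_congr rfl fun j _ => ?_
    rw [s3, Finset.mul_sum, Finset.mul_sum, Complex.ofReal_sum]
    refine Finset.sum_congr rfl fun k _ => ?_
    rw [s4, Finset.mul_sum, Finset.mul_sum, Finset.mul_sum, Complex.ofReal_sum]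
    refine Finset.sum_congr rfl fun l _ => ?_
    push_cast; ring
  have hform : ∀ X Y Z W : EuclideanSpace ℝ (Fin n), ∀ u v : Fin n → ℂ,
      (u = fun i => (X i : ℂ) + Complex.I * (Y i : ℂ)) →
      (v = fun i => (Z i : ℂ) + Complex.I * (W i : ℂ)) →
      Rc u v (star u) (star v) = ((R X Z X Z + R Y W Y W + R X W X W + R Y Z Y Z
        - 2 * R X Y Z W : ℝ) : ℂ) := by
    intro X Y Z W u v hu hv
    have hu1 : u = (fun i => (X i : ℂ)) + Complex.I • (fun i => (Y i : ℂ)) := by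
      rw [hu]; rfl
    have hv1 : v = (fun i => (Z i : ℂ)) + Complex.I • (fun i => (W i : ℂ)) := by
      rw [hv]; rfl
    have hu2 : star u = (fun i => (X i : ℂ)) + (-Complex.I) • (fun i => (Y i : ℂ)) := by
      rw [hu]; ext i; simp
    have hv2 : star v = (fun i => (Z i : ℂ)) + (-Complex.I) • (fun i => (W i : ℂ)) := by
      rw [hv]; ext i; simp
    rw [hu2, hv2, hu1, hv1]
    simp only [add1, add2, add3, add4, smul1, smul2, smul3, smul4, hreal]
    have b := hbianchi X Y Z W
    have i1 : R Y Z X W = R X W Y Z := hpair _ _ _ _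
    have i2 : R Z X Y W = - R X Z Y W := hanti _ _ _ _
    have i3 : R Y W X Z = R X Z Y W := hpair _ _ _ _
    have i4 : R X W X Z = R X Z X W := hpair _ _ _ _
    have i5 : R Y Z X Z = R X Z Y Z := hpair _ _ _ _
    have i6 : R Y W X W = R X W Y W := hpair _ _ _ _
    have i7 : R Y W Y Z = R Y Z Y W := hpair _ _ _ _
    have i8 : R X Y Z W = R X Z Y W - R X W Y Z := by linarith
    rw [i8, i1, i3, i4, i5, i6, i7]
    push_cast
    ring_nf
    simp only [Complex.I_sq, show Complex.I ^ 4 = 1 from Complex.I_pow_four]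
    ring
  by_cases h0 : U = 0 ∧ V = 0
  · have : Rc U V (star U) (star V) = 0 := by
      rw [h0.1, h0.2]; exact czero _ _ _
    rw [this]; simp
  obtain ⟨a, b, c, d, hd, u, v, hu, hv, hi, hB, hBu, hBv⟩ :=
    takagi (WithLp.toLp 2 U) (WithLp.toLp 2 V) (by
      by_contra! hh
      exact h0 ⟨by simpa using hh.1, by simpa using hh.2⟩)
  set X : EuclideanSpace ℝ (Fin n) := WithLp.toLp 2 (fun i => (u i).re) with hX
  set Y : EuclideanSpace ℝ (Fin n) := WithLp.toLp 2 (fun i => (u i).im) with hY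
  set Z : EuclideanSpace ℝ (Fin n) := WithLp.toLp 2 (fun i => (v i).re) with hZ
  set W : EuclideanSpace ℝ (Fin n) := WithLp.toLp 2 (fun i => (v i).im) with hW
  have r1 := congrArg Complex.re hi
  have r2 := congrArg Complex.im hi
  have r3 := congrArg Complex.re hB
  have r4 := congrArg Complex.im hB
  simp only [PiLp.inner_apply, RCLike.inner_apply, Complex.re_sum, Complex.im_sum, Complex.mul_re,
    Complex.mul_im, Complex.conj_re, Complex.conj_im, Complex.zero_re, Complex.zero_im,
    Finset.sum_add_distrib, Finset.sum_sub_distrib, mul_neg, Finset.sum_neg_distrib] at r1 r2 r3 r4 hBu hBv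
  have inn : ∀ p q : Fin n → ℝ, ⟪(WithLp.toLp 2 p : EuclideanSpace ℝ (Fin n)),
      (WithLp.toLp 2 q : EuclideanSpace ℝ (Fin n))⟫ = ∑ i, p i * q i := by
    intro p q
    simp [PiLp.inner_apply, mul_comm]
  have cm : ∀ p q : Fin n → ℝ, ∑ i, p i * q i = ∑ i, q i * p i := fun p q => by
    simp only [mul_comm]
  have c1 := cm (fun i => (u i).re) (fun i => (u i).im)
  have c2 := cm (fun i => (u i).re) (fun i => (v i).re)
  have c3 := cm (fun i => (u i).re) (fun i => (v i).im)
  have c4 := cm (fun i => (u i).im) (fun i => (v i).re)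
  have c5 := cm (fun i => (u i).im) (fun i => (v i).im)
  have c6 := cm (fun i => (v i).re) (fun i => (v i).im)
  have hcore := core R hanti hpair hbianchi hsec hflag4 X Y Z W
    (by rw [inn]; linarith) (by rw [inn]; linarith) (by rw [inn]; linarith)
    (by rw [inn]; linarith) (by rw [inn]; linarith) (by rw [inn]; linarith)
  have hG := hdet a b c d
  have hu' : (fun i => u i) = a • U + b • V := by rw [hu]; ext i; simp
  have hv' : (fun i => v i) = c • U + d • V := by rw [hv]; ext i; simp
  rw [hform X Y Z W (a • U + b • V) (c • U + d • V)
    (by rw [← hu']; ext i; simp [hX, hY, mul_comm Complex.I, Complex.re_add_im])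
    (by rw [← hv']; ext i; simp [hZ, hW, mul_comm Complex.I, Complex.re_add_im])] at hG
  have hN : 0 < Complex.normSq (a * d - b * c) := Complex.normSq_pos.2 hd
  have g1 := congrArg Complex.re hG
  have g2 := congrArg Complex.im hG
  rw [Complex.ofReal_re, Complex.re_ofReal_mul] at g1
  rw [Complex.ofReal_im, Complex.im_ofReal_mul] at g2
  constructor
  · by_contra! hneg
    nlinarith [mul_neg_of_pos_of_neg hN hneg]
  · rcases mul_eq_zero.1 g2.symm with h | h
    · exact absurd h hN.ne'
    · exact h
end

section
/- Let R be an algebraic curvature tensor on ℝⁿ with nonpositive sectional curvature satisfying the dual flag pinching condition λ·R_e(X,X) ≥ R_e(Y,Y) for all nonzero e and all unit X, Y orthogonal to e, with λ ≥ 1/4. Then R has nonpositive complex sectional curvature: R(U,V,Ū,V̄) ≤ 0 for all U, V ∈ ℂⁿ. -/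
open scoped RealInnerProductSpace

section helpers

set_option maxHeartbeats 1000000 in
theorem core_real {E : Type*} [NormedAddCommGroup E] [InnerProductSpace ℝ E]
    (R : E →ₗ[ℝ] E →ₗ[ℝ] E →ₗ[ℝ] E →ₗ[ℝ] ℝ)
    (hanti : ∀ X Y Z W, R X Y Z W = - R Y X Z W)
    (hpair : ∀ X Y Z W, R X Y Z W = R Z W X Y)
    (hbianchi : ∀ X Y Z W, R X Y Z W + R Y Z X W + R Z X Y W = 0)
    (hsec : ∀ X Y, R X Y X Y ≤ 0)
    (hflag : ∀ e X Y : E, ⟪e, X⟫ = 0 → ⟪e, Y⟫ = 0 →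
      ‖X‖ = ‖Y‖ → 4 * R e Y e Y ≤ R e X e X)
    (A B C D : E) (hAB : ⟪A, B⟫ = 0) (hAC : ⟪A, C⟫ = 0) (hAD : ⟪A, D⟫ = 0)
    (hBC : ⟪B, C⟫ = 0) (hBD : ⟪B, D⟫ = 0) (hCD : ⟪C, D⟫ = 0) :
    R A C A C + R A D A D + R B C B C + R B D B D + 2 * R A B C D ≤ 0 := by
  have hoff : ∀ e y z : E, ⟪e, y⟫ = 0 → ⟪e, z⟫ = 0 → ⟪y, z⟫ = 0 →
      3 * (R e y e y + R e z e z) ≤ 10 * R e y e z := by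
    intro e y z h1 h2 h3
    have hn : ‖y + z‖ = ‖y - z‖ := by
      have h5 := norm_add_sq_real y z
      have h6 := norm_sub_sq_real y z
      rw [h3] at h5 h6
      have : ‖y + z‖ ^ 2 = ‖y - z‖ ^ 2 := by rw [h5, h6]; ring
      exact (sq_eq_sq₀ (norm_nonneg _) (norm_nonneg _)).1 this
    have := hflag e (y + z) (y - z) (by rw [inner_add_right, h1, h2, add_zero])
      (by rw [inner_sub_right, h1, h2, sub_zero]) hn
    simp only [map_add, map_sub, LinearMap.add_apply, LinearMap.sub_apply] at this
    have h7 := hpair e y e z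
    linarith
  -- the basic Berger-type estimate
  have hb : ∀ A B C D : E, ⟪A, B⟫ = 0 → ⟪A, C⟫ = 0 → ⟪A, D⟫ = 0 →
      ⟪B, C⟫ = 0 → ⟪B, D⟫ = 0 → ⟪C, D⟫ = 0 →
      R A C A C + R A D A D + R B C B C + R B D B D + 2 * R A B A B + 2 * R C D C D
        ≤ - 10 * R A B C D := by
    intro A B C D hAB hAC hAD hBC hBD hCD
    have hBA : ⟪B, A⟫ = 0 := by rw [real_inner_comm]; exact hAB
    have hCA : ⟪C, A⟫ = 0 := by rw [real_inner_comm]; exact hAC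
    have hCB : ⟪C, B⟫ = 0 := by rw [real_inner_comm]; exact hBC
    have p1 := hoff (A + C) B (-D) (by simp [inner_add_left, *]) (by simp [inner_add_left, *])
      (by simp [*])
    have p2 := hoff (A - C) B D (by simp [inner_sub_left, *]) (by simp [inner_sub_left, *])
      (by simp [*])
    have q1 := hoff (B + C) A D (by simp [inner_add_left, *]) (by simp [inner_add_left, *])
      (by simp [*])
    have q2 := hoff (B - C) A (-D) (by simp [inner_sub_left, *]) (by simp [inner_sub_left, *])
      (by simp [*])
    have hsub : ∀ X X' Y Z W : E, R (X - X') Y Z W = R X Y Z W - R X' Y Z W := by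
      intro X X' Y Z W
      rw [sub_eq_add_neg, ← neg_one_smul ℝ X', map_add, map_smul]
      simp only [LinearMap.add_apply, LinearMap.smul_apply, smul_eq_mul]
      ring
    simp only [hsub, map_add, map_sub, map_neg, LinearMap.add_apply, LinearMap.sub_apply,
      LinearMap.neg_apply] at p1 p2 q1 q2
    have hbi := hbianchi A B C D
    have swap : ∀ X Y, R X Y X Y = R Y X Y X := by
      intro X Y
      rw [hanti X Y X Y, hpair Y X X Y, hanti X Y Y X, neg_neg]
    have s1 := swap A B
    have s2 := swap A C
    have s3 := swap B C
    have s4 := hanti C B A D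
    have s5 := hanti A C B D
    have s6 := hanti B A C D
    linarith
  by_cases hB : B = 0
  · subst hB
    simp only [map_zero, LinearMap.zero_apply]
    linarith [hsec A C, hsec A D]
  by_cases hC : C = 0
  · subst hC
    simp only [map_zero, LinearMap.zero_apply]
    linarith [hsec A D, hsec B D]
  by_cases hD : D = 0
  · subst hD
    simp only [map_zero, LinearMap.zero_apply]
    linarith [hsec A C, hsec B C]
  -- general flag comparison with unequal norms
  have hf2 : ∀ e X Y : E, ⟪e, X⟫ = 0 → ⟪e, Y⟫ = 0 →
      4 * (‖X‖ ^ 2 * R e Y e Y) ≤ ‖Y‖ ^ 2 * R e X e X := by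
    intro e X Y h1 h2
    have := hflag e (‖Y‖ • X) (‖X‖ • Y) (by simp [inner_smul_right, h1])
      (by simp [inner_smul_right, h2]) (by simp [norm_smul, mul_comm])
    simp only [map_smul, LinearMap.smul_apply, smul_eq_mul] at this
    nlinarith [this]
  have swap : ∀ X Y, R X Y X Y = R Y X Y X := by
    intro X Y
    rw [hanti X Y X Y, hpair Y X X Y, hanti X Y Y X, neg_neg]
  have key : ∀ A B C D : E, ⟪A, B⟫ = 0 → ⟪A, C⟫ = 0 → ⟪D, B⟫ = 0 → ⟪D, C⟫ = 0 →
      B ≠ 0 → C ≠ 0 → R A B A B * R C D C D ≤ 16 * (R A C A C * R B D B D) := by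
    intro A B C D h1 h2 h3 h4 hB hC
    have f1 := hf2 A B C h1 h2
    have f2 := hf2 A C B h2 h1
    have f3 := hf2 D B C h3 h4
    have f4 := hf2 D C B h4 h3
    rw [swap C D, swap B D]
    have hb0 : 0 < ‖B‖ ^ 2 := by positivity
    have hc0 : 0 < ‖C‖ ^ 2 := by positivity
    have := hsec A B
    have := hsec A C
    have := hsec D B
    have := hsec D C
    generalize R A B A B = x at *
    generalize R A C A C = y at *
    generalize R D B D B = z at *
    generalize R D C D C = w at *
    generalize ‖B‖ ^ 2 = b at *
    generalize ‖C‖ ^ 2 = c at *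
    have m : (c * (-x)) * (b * (-w)) ≤ (4 * (b * (-y))) * (4 * (c * (-z))) :=
      mul_le_mul (by linarith) (by linarith) (by nlinarith) (by nlinarith)
    have : (b * c) * (x * w) ≤ (b * c) * (16 * (y * z)) := by linarith
    exact le_of_mul_le_mul_left this (by positivity)
  have hDB : ⟪D, B⟫ = 0 := by rw [real_inner_comm]; exact hBD
  have hDC : ⟪D, C⟫ = 0 := by rw [real_inner_comm]; exact hCD
  have hCB : ⟪C, B⟫ = 0 := by rw [real_inner_comm]; exact hBC
  have k1 := key A B C D hAB hAC hDB hDC hB hC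
  have k2 := key A B D C hAB hAD hCB hCD hB hD
  have sCD : R D C D C = R C D C D := swap D C
  rw [sCD] at k2
  have hq : ∀ q : ℝ, 0 ≤ q →
      10 * R A B C D * q ≤ -(R A C A C + R A D A D + R B C B C + R B D B D) * q
        + 2 * q ^ 2 * (- R A B A B) + 2 * (- R C D C D) := by
    intro q hq
    obtain ⟨r, hr, rfl⟩ : ∃ r : ℝ, 0 ≤ r ∧ q = r ^ 2 :=
      ⟨Real.sqrt q, Real.sqrt_nonneg _, (Real.sq_sqrt hq).symm⟩
    have := hb (r • A) (r • B) C D (by simp [inner_smul_left, inner_smul_right, *])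
      (by simp [inner_smul_left, *]) (by simp [inner_smul_left, *])
      (by simp [inner_smul_left, *]) (by simp [inner_smul_left, *]) hCD
    simp only [map_smul, LinearMap.smul_apply, smul_eq_mul] at this
    nlinarith [this]
  have a1 := hsec A B
  have a2 := hsec C D
  have a3 := hsec A C
  have a4 := hsec A D
  have a5 := hsec B C
  have a6 := hsec B D
  generalize R A B C D = k at *
  by_contra hcon
  push Not at hcon
  generalize R A B A B = x at *
  generalize R C D C D = w at *
  generalize R A C A C = c1 at *
  generalize R B D B D = c2 at *
  generalize R A D A D = d1 at *
  generalize R B C B C = d2 at *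
  -- T = -(c1+d1+d2+c2) ; 2k > T
  have hT : x * w ≤ (c1 + c2 + d1 + d2) ^ 2 := by
    have e1 := sq_nonneg (c1 - c2)
    have e2 := sq_nonneg (d1 - d2)
    nlinarith [mul_nonneg (neg_nonneg.2 a3) (neg_nonneg.2 a4), sq_nonneg (c1 + c2 - d1 - d2),
      mul_nonneg (neg_nonneg.2 a3) (neg_nonneg.2 a5), mul_nonneg (neg_nonneg.2 a6) (neg_nonneg.2 a4),
      mul_nonneg (neg_nonneg.2 a6) (neg_nonneg.2 a5)]
  have hd := discrim_le_zero (a := -2 * x) (b := -(c1 + d1 + d2 + c2) - 10 * k) (c := -2 * w) (by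
    intro q
    rcases le_total 0 q with h | h
    · nlinarith [hq q h]
    · have : 0 ≤ (-(c1 + d1 + d2 + c2) - 10 * k) * q := mul_nonneg_of_nonpos_of_nonpos
        (by linarith) h
      nlinarith [mul_nonneg (mul_self_nonneg q) (neg_nonneg.2 a1)])
  rw [discrim] at hd
  nlinarith

open scoped ComplexOrder in
theorem takagi_red {n : ℕ} (F : (Fin n → ℂ) → (Fin n → ℂ) → ℝ)
    (htr : ∀ (a b c d : ℂ) U V, F (a • U + b • V) (c • U + d • V)
      = Complex.normSq (a * d - b * c) * F U V)
    (hbase : ∀ U V : Fin n → ℂ, U ⬝ᵥ V = 0 → U ⬝ᵥ star V = 0 → (U ⬝ᵥ U).im = 0 →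
      (V ⬝ᵥ V).im = 0 → F U V ≤ 0) (U V : Fin n → ℂ) : F U V ≤ 0 := by
  have hback : ∀ (a b c d : ℂ) U V, a * d - b * c ≠ 0 →
      F (a • U + b • V) (c • U + d • V) ≤ 0 → F U V ≤ 0 := by
    intro a b c d U V h h2
    rw [htr] at h2
    have := Complex.normSq_pos.2 h
    by_contra h3
    push Not at h3
    exact absurd h2 (not_le.2 (mul_pos this h3))
  have hz1 : ∀ V, F 0 V = 0 := by
    intro V
    have := htr 0 0 0 1 0 V
    simpa using this
  have hz2 : ∀ U, F U 0 = 0 := by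
    intro U
    have := htr 1 0 0 0 U 0
    simpa using this
  have hph : ∀ z : ℂ, ∃ w : ℂ, w ≠ 0 ∧ (w * w * z).im = 0 := by
    intro z
    by_cases hz : z = 0
    · exact ⟨1, one_ne_zero, by simp [hz]⟩
    obtain ⟨r, hr⟩ := IsAlgClosed.exists_pow_nat_eq z (n := 2) (by norm_num)
    have hr0 : r ≠ 0 := by rintro rfl; apply hz; rw [← hr]; simp
    refine ⟨star r, by simpa using hr0, ?_⟩
    rw [← hr]
    simp [pow_two]
    ring
  have h2 : ∀ U V : Fin n → ℂ, U ⬝ᵥ V = 0 → U ⬝ᵥ star V = 0 → F U V ≤ 0 := by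
    intro U V h1 h2
    obtain ⟨w, hw, hw'⟩ := hph (U ⬝ᵥ U)
    obtain ⟨w2, hw2, hw2'⟩ := hph (V ⬝ᵥ V)
    apply hback w 0 0 w2 U V (by simp [hw, hw2])
    apply hbase
    · simp [h1]
    · simp [h2]
    · simpa [mul_assoc] using hw'
    · simpa [mul_assoc] using hw2'
  have h3 : ∀ U V : Fin n → ℂ, U ⬝ᵥ star U = V ⬝ᵥ star V → U ⬝ᵥ star V = 0 →
      V ⬝ᵥ star U = 0 → F U V ≤ 0 := by
    intro U V hn h1 h1'
    by_cases hβ : U ⬝ᵥ V = 0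
    · exact h2 U V hβ h1
    obtain ⟨α, hα⟩ : ∃ α, α = U ⬝ᵥ U := ⟨_, rfl⟩
    obtain ⟨γ, hγ⟩ : ∃ γ, γ = V ⬝ᵥ V := ⟨_, rfl⟩
    obtain ⟨β, hβ'⟩ : ∃ β, β = U ⬝ᵥ V := ⟨_, rfl⟩
    rw [← hβ'] at hβ
    obtain ⟨w, hw⟩ : ∃ w, w = star β * γ + β * star α := ⟨_, rfl⟩
    obtain ⟨ω, hω, hωw⟩ : ∃ ω : ℂ, ω * star ω = 1 ∧ (w * ω).im = 0 := by
      by_cases h0 : w = 0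
      · exact ⟨1, by simp, by simp [h0]⟩
      · have hn0 : (‖w‖ : ℂ) ≠ 0 := by simpa using h0
        have hm : w * star w = (‖w‖ : ℂ) ^ 2 := Complex.mul_conj' w
        refine ⟨star w / ‖w‖, ?_, ?_⟩
        · have : star (star w / (‖w‖ : ℂ)) = w / ‖w‖ := by simp
          rw [this]
          field_simp
          rw [mul_comm, hm]
        · rw [← mul_div_assoc, hm, pow_two, mul_div_assoc, div_self hn0]
          simp
    obtain ⟨t, ht⟩ : ∃ t : ℝ, γ * ω - α * star ω = t * β := by
      refine ⟨(star β * (γ * ω - α * star ω)).re / Complex.normSq β, ?_⟩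
      have him : (star β * (γ * ω - α * star ω)).im = 0 := by
        rw [hw] at hωw
        simp at hωw ⊢
        linarith
      have hre : (((star β * (γ * ω - α * star ω)).re : ℝ) : ℂ)
          = star β * (γ * ω - α * star ω) := by
        apply Complex.ext <;> simp only [Complex.ofReal_re, Complex.ofReal_im, him]
      have hN : (Complex.normSq β : ℂ) = β * star β := (Complex.mul_conj β).symm
      have hsβ : star β ≠ 0 := by simpa using hβ
      rw [Complex.ofReal_div, hre, hN]
      field_simp
    obtain ⟨c, hc⟩ : ∃ c : ℝ, c ^ 2 - 1 + c * t = 0 := by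
      refine ⟨(-t + Real.sqrt (t ^ 2 + 4)) / 2, ?_⟩
      have := Real.sq_sqrt (show 0 ≤ t ^ 2 + 4 by positivity)
      nlinarith
    have hcc : (c : ℂ) ^ 2 - 1 + c * t = 0 := by exact_mod_cast hc
    have hdet : (c : ℂ) * c - ω * (-star ω) ≠ 0 := by
      have e : (c : ℂ) * c - ω * (-star ω) = ((c * c + 1 : ℝ) : ℂ) := by
        push_cast
        linear_combination hω
      rw [e]
      have : c * c + 1 ≠ 0 := by nlinarith [mul_self_nonneg c]
      exact_mod_cast this
    apply hback (c : ℂ) ω (-star ω) c U V hdet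
    apply h2
    · simp only [add_dotProduct, dotProduct_add, smul_dotProduct, dotProduct_smul, smul_eq_mul]
      rw [dotProduct_comm V U, ← hα, ← hγ, ← hβ']
      linear_combination (c : ℂ) * ht + β * hcc - β * hω
    · simp only [star_add, star_smul, add_dotProduct, dotProduct_add, smul_dotProduct,
        dotProduct_smul, smul_eq_mul, h1, h1', hn, star_neg, star_star]
      have : star (c : ℂ) = c := Complex.conj_ofReal c
      rw [this]
      ring
  have hnn : ∀ U : Fin n → ℂ, U ≠ 0 → ∃ r : ℝ, 0 < r ∧ U ⬝ᵥ star U = r := by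
    intro U hU
    have h0 := Matrix.dotProduct_self_star_pos_iff.2 hU
    rw [Complex.lt_def] at h0
    refine ⟨(U ⬝ᵥ star U).re, h0.1, ?_⟩
    apply Complex.ext
    · simp
    · simpa using h0.2.symm
  have hcj : ∀ U V : Fin n → ℂ, U ⬝ᵥ star V = 0 → V ⬝ᵥ star U = 0 := by
    intro U V h
    have := congrArg star h
    simpa [dotProduct, mul_comm] using this
  have h4 : ∀ U V : Fin n → ℂ, U ⬝ᵥ star V = 0 → F U V ≤ 0 := by
    intro U V h
    by_cases hU : U = 0
    · rw [hU, hz1]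
    by_cases hV : V = 0
    · rw [hV, hz2]
    obtain ⟨r, hr, hr'⟩ := hnn U hU
    obtain ⟨s, hs, hs'⟩ := hnn V hV
    have h' := hcj U V h
    apply hback (Real.sqrt s : ℂ) 0 0 (Real.sqrt r : ℂ) U V
    · have : Real.sqrt s * Real.sqrt r ≠ 0 := by positivity
      simpa using (by exact_mod_cast this : (Real.sqrt s : ℂ) * (Real.sqrt r : ℂ) ≠ 0)
    · have e1 : (Real.sqrt s : ℂ) * (Real.sqrt s : ℂ) = s := by
        exact_mod_cast Real.mul_self_sqrt hs.le
      have e2 : (Real.sqrt r : ℂ) * (Real.sqrt r : ℂ) = r := by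
        exact_mod_cast Real.mul_self_sqrt hr.le
      apply h3
      · simp only [zero_smul, add_zero, zero_add, star_smul, smul_dotProduct, dotProduct_smul,
          smul_eq_mul, hr', hs']
        have c1 : star (Real.sqrt s : ℂ) = Real.sqrt s := Complex.conj_ofReal _
        have c2 : star (Real.sqrt r : ℂ) = Real.sqrt r := Complex.conj_ofReal _
        rw [c1, c2]
        linear_combination (r : ℂ) * e1 - s * e2
      · simp [h]
      · simp [h']
  by_cases hU : U = 0
  · rw [hU, hz1]
  obtain ⟨r, hr, hr'⟩ := hnn U hU
  apply hback 1 0 (-(V ⬝ᵥ star U) / r) 1 U V (by simp)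
  apply h4
  apply hcj
  have : (r : ℂ) ≠ 0 := by exact_mod_cast hr.ne'
  simp [hr']
  field_simp
  simp

end helpers

/-- Corollary 4.1 of Ni–Wilking (algebraic form): an algebraic curvature tensor
on `ℝⁿ` (`n ≥ 4`) with nonpositive sectional curvature satisfying the dual flag
pinching condition `λ·R_e(X,X) ≥ R_e(Y,Y)` (for all nonzero `e` and unit
`X, Y ⊥ e`) with `λ ≥ 1/4` has nonpositive complex sectional curvature:
`R(U,V,Ū,V̄) ≤ 0` (in particular it is real) for all `U, V ∈ ℂⁿ`. -/
theorem stmt_14 (n : ℕ) (hn : 4 ≤ n)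
    (R : EuclideanSpace ℝ (Fin n) →ₗ[ℝ] EuclideanSpace ℝ (Fin n) →ₗ[ℝ]
      EuclideanSpace ℝ (Fin n) →ₗ[ℝ] EuclideanSpace ℝ (Fin n) →ₗ[ℝ] ℝ)
    (hanti : ∀ X Y Z W, R X Y Z W = - R Y X Z W)
    (hpair : ∀ X Y Z W, R X Y Z W = R Z W X Y)
    (hbianchi : ∀ X Y Z W, R X Y Z W + R Y Z X W + R Z X Y W = 0)
    (hsec : ∀ X Y, R X Y X Y ≤ 0)
    (lam : ℝ) (hlam : 1 / 4 ≤ lam)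
    (hflag : ∀ e X Y : EuclideanSpace ℝ (Fin n), e ≠ 0 → ⟪e, X⟫ = 0 → ⟪e, Y⟫ = 0 →
      ‖X‖ = ‖Y‖ → R e Y e Y ≤ lam * R e X e X)
    -- the complex-multilinear extension of `R` to `ℂⁿ`, in coordinates
    (Rc : (Fin n → ℂ) → (Fin n → ℂ) → (Fin n → ℂ) → (Fin n → ℂ) → ℂ)
    (hRc : ∀ U V S T, Rc U V S T =
      ∑ i, ∑ j, ∑ k, ∑ l, U i * V j * S k * T l *
        (R (EuclideanSpace.single i 1) (EuclideanSpace.single j 1)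
          (EuclideanSpace.single k 1) (EuclideanSpace.single l 1) : ℂ))
    (U V : Fin n → ℂ) :
    (Rc U V (star U) (star V)).re ≤ 0 ∧ (Rc U V (star U) (star V)).im = 0 := by
  -- multilinearity and symmetries of `Rc`
  have hadd : ∀ U U' V S T, Rc (U + U') V S T = Rc U V S T + Rc U' V S T := by
    intro U U' V S T
    simp only [hRc, ← Finset.sum_add_distrib, Pi.add_apply]
    refine Finset.sum_congr rfl fun i _ => Finset.sum_congr rfl fun j _ =>
      Finset.sum_congr rfl fun k _ => Finset.sum_congr rfl fun l _ => ?_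
    ring
  have hsmul : ∀ (a : ℂ) U V S T, Rc (a • U) V S T = a * Rc U V S T := by
    intro a U V S T
    simp only [hRc, Finset.mul_sum, Pi.smul_apply, smul_eq_mul]
    refine Finset.sum_congr rfl fun i _ => Finset.sum_congr rfl fun j _ =>
      Finset.sum_congr rfl fun k _ => Finset.sum_congr rfl fun l _ => ?_
    ring
  have hant : ∀ U V S T, Rc U V S T = - Rc V U S T := by
    intro U V S T
    rw [hRc, hRc, Finset.sum_comm]
    simp only [← Finset.sum_neg_distrib]
    refine Finset.sum_congr rfl fun i _ => Finset.sum_congr rfl fun j _ =>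
      Finset.sum_congr rfl fun k _ => Finset.sum_congr rfl fun l _ => ?_
    rw [hanti]
    push_cast
    ring
  have hpr : ∀ U V S T, Rc U V S T = Rc S T U V := by
    intro U V S T
    rw [hRc, hRc]
    simp only [← Fintype.sum_prod_type']
    rw [← Equiv.sum_comp (⟨fun p => (p.2.2.1, p.2.2.2, p.1, p.2.1),
      fun p => (p.2.2.1, p.2.2.2, p.1, p.2.1), fun _ => rfl, fun _ => rfl⟩ :
        (Fin n × Fin n × Fin n × Fin n) ≃ (Fin n × Fin n × Fin n × Fin n))]
    refine Finset.sum_congr rfl fun p _ => ?_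
    simp only [Equiv.coe_fn_mk]
    rw [hpair]
    ring
  have hadd2 : ∀ U V V' S T, Rc U (V + V') S T = Rc U V S T + Rc U V' S T := by
    intro U V V' S T
    rw [hant, hadd, hant V, hant V']; ring
  have hsmul2 : ∀ (a : ℂ) U V S T, Rc U (a • V) S T = a * Rc U V S T := by
    intro a U V S T
    rw [hant, hsmul, hant V]; ring
  have hadd3 : ∀ U V S S' T, Rc U V (S + S') T = Rc U V S T + Rc U V S' T := by
    intro U V S S' T
    rw [hpr, hadd, hpr S, hpr S']
  have hsmul3 : ∀ (a : ℂ) U V S T, Rc U V (a • S) T = a * Rc U V S T := by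
    intro a U V S T
    rw [hpr, hsmul, hpr S]
  have hadd4 : ∀ U V S T T', Rc U V S (T + T') = Rc U V S T + Rc U V S T' := by
    intro U V S T T'
    rw [hpr, hadd2, hpr S, hpr S]
  have hsmul4 : ∀ (a : ℂ) U V S T, Rc U V S (a • T) = a * Rc U V S T := by
    intro a U V S T
    rw [hpr, hsmul2, hpr S]
  have hant2 : ∀ U V S T, Rc U V S T = - Rc U V T S := by
    intro U V S T
    rw [hpr, hant, hpr T]
  have hs1 : ∀ U S T, Rc U U S T = 0 := by
    intro U S T
    exact self_eq_neg.1 (hant U U S T)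
  have hs2 : ∀ U V S, Rc U V S S = 0 := by
    intro U V S
    exact self_eq_neg.1 (hant2 U V S S)
  -- real vectors
  have hreal : ∀ A B C D : EuclideanSpace ℝ (Fin n),
      Rc (fun i => (A i : ℂ)) (fun i => (B i : ℂ)) (fun i => (C i : ℂ)) (fun i => (D i : ℂ))
        = (R A B C D : ℂ) := by
    intro A B C D
    have hexp : ∀ X : EuclideanSpace ℝ (Fin n),
        X = ∑ i, X i • EuclideanSpace.single i (1 : ℝ) := by
      intro X
      ext j
      simp [Finset.sum_apply, Pi.single_apply]
    conv_rhs => rw [hexp A, hexp B, hexp C, hexp D]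
    rw [hRc]
    simp only [map_sum, map_smul, LinearMap.sum_apply, LinearMap.smul_apply, smul_eq_mul,
      Finset.mul_sum, Complex.ofReal_sum, Complex.ofReal_mul]
    simp only [← Fintype.sum_prod_type']
    rw [← Equiv.sum_comp (⟨fun p => (p.2.2.2, p.2.2.1, p.2.1, p.1),
      fun p => (p.2.2.2, p.2.2.1, p.2.1, p.1), fun _ => rfl, fun _ => rfl⟩ :
        (Fin n × Fin n × Fin n × Fin n) ≃ (Fin n × Fin n × Fin n × Fin n))]
    refine Finset.sum_congr rfl fun p _ => ?_
    simp only [Equiv.coe_fn_mk]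
    ring
  have hflag' : ∀ e X Y : EuclideanSpace ℝ (Fin n), ⟪e, X⟫ = 0 → ⟪e, Y⟫ = 0 →
      ‖X‖ = ‖Y‖ → 4 * R e Y e Y ≤ R e X e X := by
    intro e X Y h1 h2 h3
    by_cases he : e = 0
    · subst he; simp
    · have := hflag e X Y he h1 h2 h3
      nlinarith [hsec e X]
  refine ⟨?_, ?_⟩
  · refine takagi_red (fun U V => (Rc U V (star U) (star V)).re) ?_ ?_ U V
    · intro a b c d U V
      have : Rc (a • U + b • V) (c • U + d • V) (star (a • U + b • V)) (star (c • U + d • V))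
          = ((a * d - b * c) * star (a * d - b * c)) * Rc U V (star U) (star V) := by
        simp only [star_add, star_smul, hadd, hadd2, hadd3, hadd4, hsmul, hsmul2, hsmul3, hsmul4,
          hs1, hs2]
        have f1 := hant V U (star U) (star V)
        have f2 := hant2 U V (star V) (star U)
        have f3 : Rc V U (star V) (star U) = Rc U V (star U) (star V) := by
          rw [hant V U, f2, neg_neg]
        rw [f1, f2, f3]
        simp only [star_sub, star_mul]
        ring
      simp only [this]
      have e : (a * d - b * c) * star (a * d - b * c) = (Complex.normSq (a * d - b * c) : ℂ) :=
        Complex.mul_conj _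
      rw [e, Complex.re_ofReal_mul]
    · intro U V h1 h2 h3 h4
      obtain ⟨A, hA⟩ : ∃ A : EuclideanSpace ℝ (Fin n), ∀ i, A i = (U i).re :=
        ⟨WithLp.toLp 2 fun i => (U i).re, fun i => rfl⟩
      obtain ⟨B, hB⟩ : ∃ A : EuclideanSpace ℝ (Fin n), ∀ i, A i = (U i).im :=
        ⟨WithLp.toLp 2 fun i => (U i).im, fun i => rfl⟩
      obtain ⟨C, hC⟩ : ∃ A : EuclideanSpace ℝ (Fin n), ∀ i, A i = (V i).re :=
        ⟨WithLp.toLp 2 fun i => (V i).re, fun i => rfl⟩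
      obtain ⟨D, hD⟩ : ∃ A : EuclideanSpace ℝ (Fin n), ∀ i, A i = (V i).im :=
        ⟨WithLp.toLp 2 fun i => (V i).im, fun i => rfl⟩
      have hin : ∀ X Y : EuclideanSpace ℝ (Fin n), ⟪X, Y⟫ = ∑ i, X i * Y i := by
        intro X Y
        simp [PiLp.inner_apply, mul_comm]
      have r1 := congrArg Complex.re h1
      have i1 := congrArg Complex.im h1
      have r2 := congrArg Complex.re h2
      have i2 := congrArg Complex.im h2
      simp only [dotProduct, Complex.re_sum, Complex.im_sum, Complex.mul_re, Complex.mul_im,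
        Pi.star_apply, Complex.star_def, Complex.conj_re, Complex.conj_im, Complex.zero_re,
        Complex.zero_im, mul_neg, sub_neg_eq_add, Finset.sum_add_distrib, Finset.sum_sub_distrib,
        Finset.sum_neg_distrib, ← hA, ← hB, ← hC, ← hD, ← hin] at r1 i1 r2 i2 h3 h4
      simp only [hin] at h3 h4 r1 r2 i1 i2
      have oAB : ⟪A, B⟫ = 0 := by
        have : ∑ i, B i * A i = ∑ i, A i * B i := by simp only [mul_comm]
        rw [hin]; linarith
      have oCD : ⟪C, D⟫ = 0 := by
        have : ∑ i, D i * C i = ∑ i, C i * D i := by simp only [mul_comm]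
        rw [hin]; linarith
      have oAC : ⟪A, C⟫ = 0 := by rw [hin]; linarith
      have oBD : ⟪B, D⟫ = 0 := by rw [hin]; linarith
      have oAD : ⟪A, D⟫ = 0 := by rw [hin]; linarith
      have oBC : ⟪B, C⟫ = 0 := by rw [hin]; linarith
      have eU : U = (fun i => (A i : ℂ)) + Complex.I • (fun i => (B i : ℂ)) := by
        ext i
        simp only [Pi.add_apply, Pi.smul_apply, hA, hB, smul_eq_mul]
        rw [mul_comm, Complex.re_add_im]
      have eV : V = (fun i => (C i : ℂ)) + Complex.I • (fun i => (D i : ℂ)) := by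
        ext i
        simp only [Pi.add_apply, Pi.smul_apply, hC, hD, smul_eq_mul]
        rw [mul_comm, Complex.re_add_im]
      have sreal : ∀ X : EuclideanSpace ℝ (Fin n),
          star (fun i => (X i : ℂ)) = (fun i => (X i : ℂ)) := by
        intro X; ext i; simp
      have sI : star Complex.I = - Complex.I := Complex.conj_I
      have c1 := core_real R hanti hpair hbianchi hsec hflag' A B C D oAB oAC oAD oBC oBD oCD
      have c2 := core_real R hanti hpair hbianchi hsec hflag' A B C (-D) oAB oAC
        (by simp [oAD]) oBC (by simp [oBD]) (by simp [oCD])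
      simp only [map_neg, LinearMap.neg_apply] at c2
      have b1 := hbianchi A B C D
      have b2 := hanti C A B D
      have b3 := hpair A D B C
      have b4 := hpair A C B D
      rw [eU, eV]
      simp only [star_add, star_smul, sreal, sI, hadd, hadd2, hadd3, hadd4, hsmul, hsmul2, hsmul3,
        hsmul4, hreal]
      simp
      linarith
  · have hconj : ∀ U V S T, star (Rc U V S T) = Rc (star U) (star V) (star S) (star T) := by
      intro U V S T
      rw [hRc, hRc]
      simp
    have := hconj U V (star U) (star V)
    rw [star_star, star_star, hpr (star U)] at this
    exact Complex.conj_eq_iff_im.1 this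
end

section
/- Let n = 2m+1 be odd and let Rm be an algebraic curvature operator on ℝⁿ with nonnegative sectional curvature, positive scalar curvature, and λ-pinched flag curvature where λ > 2(m−1)/(8m−5). Then the operator Ric ∧ id − Rm is positive definite on Λ²ℝⁿ: ⟨(Ric ∧ id − Rm)(Ω), Ω⟩ > 0 for every nonzero two-form Ω. -/
open scoped RealInnerProductSpace BigOperators

/-- The inner product on `Λ²ℝⁿ ≅ 𝔰𝔬(n)`, `⟨A,B⟩ = (1/2)·tr(AᵀB)`. -/
noncomputable def soInner {n : ℕ} (A B : Fin n → Fin n → ℝ) : ℝ :=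
  (1 / 2) * ∑ a, ∑ b, A a b * B a b

/-- The curvature operator `Rm` acting on `Λ²ℝⁿ ≅ 𝔰𝔬(n)`, in components. -/
noncomputable def rmOp {n : ℕ} (R4 : Fin n → Fin n → Fin n → Fin n → ℝ)
    (M : Fin n → Fin n → ℝ) : Fin n → Fin n → ℝ :=
  fun k l => (1 / 2) * ∑ i, ∑ j, R4 i j k l * M i j

/-- The operator `Ric ∧ id` on `Λ²ℝⁿ`, in components, where
`Ric a b = ∑ i, R4 a i b i` and `(A ∧ B)(X∧Y) = (1/2)(A(X)∧B(Y)+B(X)∧A(Y))`. -/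
noncomputable def ricWedgeId {n : ℕ} (R4 : Fin n → Fin n → Fin n → Fin n → ℝ)
    (M : Fin n → Fin n → ℝ) : Fin n → Fin n → ℝ :=
  fun a b => (1 / 2) * ∑ k, ((∑ i, R4 a i k i) * M k b + M a k * (∑ i, R4 k i b i))

section helpers

variable {E : Type*} [NormedAddCommGroup E] [InnerProductSpace ℝ E]

/-- Bound on the mixed curvature term under the flag condition. -/
lemma mix_bound (R : E →ₗ[ℝ] E →ₗ[ℝ] E →ₗ[ℝ] E →ₗ[ℝ] ℝ)
    (hanti : ∀ X Y Z W, R X Y Z W = - R Y X Z W)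
    (hpair : ∀ X Y Z W, R X Y Z W = R Z W X Y)
    (hbianchi : ∀ X Y Z W, R X Y Z W + R Y Z X W + R Z X Y W = 0)
    (lam : ℝ)
    (hflag : ∀ e X Y : E, e ≠ 0 → ⟪e, X⟫ = 0 → ⟪e, Y⟫ = 0 →
      ‖X‖ = ‖Y‖ → lam * R e Y e Y ≤ R e X e X)
    (p q r s : E) (hpq : ⟪p, q⟫ = 0) (hpr : ⟪p, r⟫ = 0) (hps : ⟪p, s⟫ = 0)
    (hqr : ⟪q, r⟫ = 0) (hqs : ⟪q, s⟫ = 0) (hrs : ⟪r, s⟫ = 0) (a b : ℝ)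
    (ha : 0 ≤ a) (hb : 0 ≤ b) :
    6 * (1 + lam) * (a * b * R p q r s) ≤ (1 - lam) *
      (2 * a ^ 2 * R p q p q + 2 * b ^ 2 * R r s r s
        + a * b * (R p r p r + R p s p s + R q r q r + R q s q s)) := by
  have hflag' : ∀ e X Y : E, ⟪e, X⟫ = 0 → ⟪e, Y⟫ = 0 →
      ‖X‖ = ‖Y‖ → lam * R e Y e Y ≤ R e X e X := by
    intro e X Y h1 h2 h3
    by_cases he : e = 0
    · subst he; simp
    · exact hflag e X Y he h1 h2 h3
  obtain ⟨x, rfl⟩ : ∃ x, a = x ^ 2 := ⟨√a, (Real.sq_sqrt ha).symm⟩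
  obtain ⟨y, rfl⟩ : ∃ y, b = y ^ 2 := ⟨√b, (Real.sq_sqrt hb).symm⟩
  -- one mixed block
  have block : ∀ p q r s : E, ⟪p, q⟫ = 0 → ⟪p, s⟫ = 0 → ⟪q, r⟫ = 0 → ⟪q, s⟫ = 0 →
      ⟪r, s⟫ = 0 →
      2 * (1 + lam) * (x ^ 2 * y ^ 2 * (R p q r s + R p s r q)) ≤ (1 - lam) *
        (x ^ 4 * R p q p q + y ^ 4 * R r s r s
          + x ^ 2 * y ^ 2 * (R p s p s + R r q r q)) := by
    intro p q r s hpq hps hqr hqs hrs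
    have hrq : ⟪r, q⟫ = 0 := by rw [real_inner_comm]; exact hqr
    have h : ∀ y : ℝ, lam * R (x • p + y • r) (x • q + y • s) (x • p + y • r) (x • q + y • s) ≤
        R (x • p + y • r) (x • q + (-y) • s) (x • p + y • r) (x • q + (-y) • s) := by
      intro y
      apply hflag'
      · simp [inner_add_left, inner_add_right, inner_smul_left, inner_smul_right, *]
      · simp [inner_add_left, inner_add_right, inner_smul_left, inner_smul_right, *]
      · rw [← sq_eq_sq₀ (norm_nonneg _) (norm_nonneg _), norm_add_sq_real, norm_add_sq_real]
        simp [inner_smul_left, inner_smul_right, hqs, norm_smul]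
    have h1 := h y
    have h2 := h (-y)
    simp only [map_add, map_smul, LinearMap.add_apply,
      LinearMap.smul_apply, smul_eq_mul] at h1 h2
    have e1 := hpair r s p q
    have e2 := hpair r q p s
    rw [e1, e2] at h1 h2
    linarith
  have B1 := block p q r s hpq hps hqr hqs hrs
  have B2 := block p q s (-r) hpq (by simp [hpr]) hqs (by simp [hqr])
    (by rw [inner_neg_right, real_inner_comm, hrs, neg_zero])
  simp only [map_neg, LinearMap.neg_apply, neg_neg] at B2
  have c1 : R p q s r = - R p q r s := by
    rw [hpair, hanti, hpair]
  have c2 : R s r s r = R r s r s := by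
    rw [hanti, hpair, hanti, neg_neg]
  have c3 : R s q s q = R q s q s := by
    rw [hanti, hpair, hanti, neg_neg]
  have c4 : R r q r q = R q r q r := by
    rw [hanti, hpair, hanti, neg_neg]
  have c5 : R p s r q = R p r s q + R p q r s := by
    have h := hbianchi p r s q
    have h1 := hpair r s p q
    have h2 := hanti s p r q
    linarith
  rw [c1, c2, c3] at B2
  rw [c4, c5] at B1
  linarith

lemma sec_pos [FiniteDimensional ℝ E] (R : E →ₗ[ℝ] E →ₗ[ℝ] E →ₗ[ℝ] E →ₗ[ℝ] ℝ)
    (hanti : ∀ X Y Z W, R X Y Z W = - R Y X Z W)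
    (hpair : ∀ X Y Z W, R X Y Z W = R Z W X Y)
    (hsec : ∀ X Y, 0 ≤ R X Y X Y)
    (lam : ℝ) (hlam : 0 < lam)
    (hflag : ∀ e X Y : E, e ≠ 0 → ⟪e, X⟫ = 0 → ⟪e, Y⟫ = 0 →
      ‖X‖ = ‖Y‖ → lam * R e Y e Y ≤ R e X e X)
    (hne : ∃ X Y, R X Y X Y ≠ 0) (u v : E) (hu : u ≠ 0) (hv : v ≠ 0) (huv : ⟪u, v⟫ = 0) :
    0 < R u v u v := by
  have self0 : ∀ X Z W, R X X Z W = 0 := fun X Z W => by linarith [hanti X X Z W]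
  have self0' : ∀ X Z W, R Z W X X = 0 := fun X Z W => by rw [hpair]; exact self0 _ _ _
  have symm : ∀ X Y, R X Y X Y = R Y X Y X := fun X Y => by
    rw [hanti, hpair, hanti, neg_neg]
  -- decomposition
  have decomp : ∀ e Y : E, e ≠ 0 → ∃ Z, ⟪e, Z⟫ = 0 ∧ (∃ c : ℝ, Y = Z + c • e) ∧
      R e Y e Y = R e Z e Z := by
    intro e Y he
    have hee : ⟪e, e⟫ ≠ 0 := by simpa using he
    refine ⟨Y - (⟪e, Y⟫ / ⟪e, e⟫) • e, ?_, ⟨⟪e, Y⟫ / ⟪e, e⟫, by simp⟩, ?_⟩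
    · rw [inner_sub_right, inner_smul_right]; field_simp; simp
    · simp [self0, self0']
  have key : ∀ e X : E, e ≠ 0 → X ≠ 0 → ⟪e, X⟫ = 0 → R e X e X = 0 → ∀ Y, R e Y e Y = 0 := by
    intro e X he hX heX h0 Y
    obtain ⟨Z, hZ, -, hYZ⟩ := decomp e Y he
    rw [hYZ]
    have h := hflag e ((‖Z‖ / ‖X‖) • X) Z he (by rw [inner_smul_right, heX, mul_zero]) hZ
      (by rw [norm_smul, Real.norm_of_nonneg (by positivity)]
          have : ‖X‖ ≠ 0 := by simpa using hX
          field_simp)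
    simp only [map_smul, LinearMap.smul_apply, smul_eq_mul, h0, mul_zero] at h
    have := hsec e Z
    nlinarith
  refine lt_of_le_of_ne (hsec u v) fun h0 => ?_
  have hu0 := key u v hu hv huv h0.symm
  obtain ⟨X, Y, hXY⟩ := hne
  apply hXY
  have hX : X ≠ 0 := by rintro rfl; simp at hXY
  obtain ⟨Z, hZ, ⟨c, hc⟩, hYZ⟩ := decomp X u hX
  by_cases hZ0 : Z = 0
  · have : u = c • X := by rw [hc, hZ0, zero_add]
    have h := hu0 Y
    have hc0 : c ≠ 0 := by rintro rfl; simp at this; exact hu this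
    rw [this] at h
    simpa [hc0] using h
  · exact key X Z hX hZ0 hZ (by rw [← hYZ, symm]; exact hu0 X) Y

/-- trace is basis independent -/
lemma trace_indep {ι κ : Type*} [Fintype ι] [Fintype κ] (b : OrthonormalBasis ι ℝ E)
    (c : OrthonormalBasis κ ℝ E) (B : E →ₗ[ℝ] E →ₗ[ℝ] ℝ) :
    ∑ i, B (b i) (b i) = ∑ j, B (c j) (c j) := by
  classical
  have h : ∀ i, B (b i) (b i) = ∑ j, ∑ k, ⟪c j, b i⟫ * ⟪b i, c k⟫ * B (c j) (c k) := by
    intro i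
    conv_lhs => rw [← c.sum_repr' (b i)]
    simp only [map_sum, LinearMap.sum_apply, map_smul, LinearMap.smul_apply, smul_eq_mul,
      Finset.mul_sum]
    rw [Finset.sum_comm]
    refine Finset.sum_congr rfl fun j _ => Finset.sum_congr rfl fun k _ => ?_
    rw [real_inner_comm (b i) (c k)]; ring
  simp_rw [h]
  rw [Finset.sum_comm]
  refine Finset.sum_congr rfl fun j _ => ?_
  rw [Finset.sum_comm]
  simp_rw [← Finset.sum_mul, b.sum_inner_mul_inner]
  simp [orthonormal_iff_ite.1 c.orthonormal]

end helpers

/-- normal form of skew maps in odd dimension -/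
lemma normal_form (m : ℕ) : ∀ (E : Type) [NormedAddCommGroup E] [InnerProductSpace ℝ E]
    [FiniteDimensional ℝ E] (_ : Module.finrank ℝ E = 2 * m + 1) (A : E →ₗ[ℝ] E)
    (_ : ∀ x y, ⟪A x, y⟫ = - ⟪x, A y⟫),
    ∃ (u v : Fin m → E) (w : E) (a : Fin m → ℝ),
      Orthonormal ℝ (Sum.elim u (Sum.elim v (fun _ : Unit => w))) ∧
      (∀ i, 0 ≤ a i) ∧ (∀ i, A (u i) = a i • v i) ∧ (∀ i, A (v i) = -(a i • u i)) ∧ A w = 0 := by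
  induction m with
  | zero =>
    intro E _ _ _ hE A hA
    let b := stdOrthonormalBasis ℝ E
    let i0 : Fin (Module.finrank ℝ E) := ⟨0, by omega⟩
    have hall : ∀ i, i = i0 := fun i => by ext; have := i.2; simp [i0]; omega
    refine ⟨Fin.elim0, Fin.elim0, b i0, Fin.elim0, ?_, fun i => i.elim0, fun i => i.elim0,
      fun i => i.elim0, ?_⟩
    · constructor
      · rintro (i | i | i)
        · exact i.elim0
        · exact i.elim0
        · simp
      · rintro (i | i | i) (j | j | j) hij
        · exact i.elim0
        · exact i.elim0
        · exact i.elim0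
        · exact i.elim0
        · exact i.elim0
        · exact i.elim0
        · exact j.elim0
        · exact j.elim0
        · exact absurd rfl hij
    · refine InnerProductSpace.ext_inner_left_basis (𝕜 := ℝ) b.toBasis fun i => ?_
      rw [hall i]
      have := hA (b i0) (b i0)
      rw [real_inner_comm] at this
      simp
      linarith
  | succ m ih =>
    intro E _ _ _ hE A hA
    by_cases hA0 : A = 0
    · subst hA0
      let b := stdOrthonormalBasis ℝ E
      let f : Fin (m+1) ⊕ Fin (m+1) ⊕ Unit ≃ Fin (Module.finrank ℝ E) :=
        Fintype.equivOfCardEq (by simp [hE]; omega)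
      refine ⟨fun i => b (f (.inl i)), fun i => b (f (.inr (.inl i))),
        b (f (.inr (.inr ()))), 0, ?_, by simp, by simp, by simp, by simp⟩
      have := b.orthonormal.comp f f.injective
      convert this using 1
      ext (i | i | i) <;> rfl
    · have hsym : (A ∘ₗ A).IsSymmetric := fun x y => by
        simp only [LinearMap.comp_apply, hA, neg_neg]
      let b := hsym.eigenvectorBasis rfl
      obtain ⟨i, hi⟩ : ∃ i, A (b i) ≠ 0 := by
        by_contra! h
        exact hA0 (b.toBasis.ext fun i => by simpa using h i)
      obtain ⟨p, hp⟩ : ∃ p, p = b i := ⟨_, rfl⟩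
      have hpn : ‖p‖ = 1 := by rw [hp]; simp
      obtain ⟨μ, hμ⟩ : ∃ μ : ℝ, A (A p) = μ • p :=
        ⟨_, by rw [hp]; exact hsym.apply_eigenvectorBasis rfl i⟩
      rw [← hp] at hi
      set t := ‖A p‖ with ht
      have ht0 : 0 < t := norm_pos_iff.2 hi
      have hμt : μ = - t ^ 2 := by
        have h := hA (A p) p
        rw [hμ, inner_smul_left, real_inner_self_eq_norm_sq, real_inner_self_eq_norm_sq, hpn] at h
        simpa using h
      obtain ⟨q, hq⟩ : ∃ q, q = t⁻¹ • A p := ⟨_, rfl⟩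
      have hqn : ‖q‖ = 1 := by
        rw [hq, norm_smul, ← ht, norm_inv, Real.norm_of_nonneg ht0.le]; field_simp
      have hAp : A p = t • q := by rw [hq, smul_smul]; field_simp; simp
      have hAq : A q = -(t • p) := by
        rw [hq, map_smul, hμ, hμt, smul_smul, ← neg_smul]; congr 1; field_simp
      have hpq : ⟪p, q⟫ = 0 := by
        have := hA p p
        rw [real_inner_comm, hAp, inner_smul_right] at this
        have h2 : t * ⟪p, q⟫ = 0 := by linarith
        exact (mul_eq_zero.1 h2).resolve_left ht0.ne'
      have hon : Orthonormal ℝ ![p, q] := by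
        constructor
        · intro i; fin_cases i <;> simp [hpn, hqn]
        · intro i j hij
          fin_cases i <;> fin_cases j <;> simp_all [real_inner_comm]
      let V := Submodule.span ℝ (Set.range ![p, q])
      have hV : Module.finrank ℝ V = 2 := by
        have := finrank_span_eq_card hon.linearIndependent
        simpa using this
      have hF : Module.finrank ℝ Vᗮ = 2 * m + 1 := by
        have := V.finrank_add_finrank_orthogonal
        omega
      have memF : ∀ x, x ∈ Vᗮ ↔ ⟪p, x⟫ = 0 ∧ ⟪q, x⟫ = 0 := by
        intro x
        constructor
        · intro h
          exact ⟨h p (Submodule.subset_span ⟨0, rfl⟩), h q (Submodule.subset_span ⟨1, rfl⟩)⟩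
        · rintro ⟨h1, h2⟩
          rw [Submodule.mem_orthogonal]
          intro y hy
          induction hy using Submodule.span_induction with
          | mem y hy => 
            obtain ⟨i, rfl⟩ := hy
            fin_cases i
            · exact h1
            · exact h2
          | zero => simp
          | add y z _ _ h1 h2 => rw [inner_add_left, h1, h2, add_zero]
          | smul c y _ h => rw [inner_smul_left, h, mul_zero]
      have hinv : ∀ x ∈ Vᗮ, A x ∈ Vᗮ := by
        intro x hx
        rw [memF] at hx ⊢
        have h1 := hA p x
        have h2 := hA q x
        rw [hAp, inner_smul_left, hx.2] at h1
        rw [hAq, inner_neg_left, inner_smul_left, hx.1] at h2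
        constructor <;> simp_all
      obtain ⟨u, v, w, a, hO, ha, hu, hv, hw⟩ := ih Vᗮ hF (A.restrict hinv)
        (fun x y => by simpa using hA x y)
      have mp : ∀ x : Vᗮ, ⟪p, (x : E)⟫ = 0 := fun x => ((memF x).1 x.2).1
      have mq : ∀ x : Vᗮ, ⟪q, (x : E)⟫ = 0 := fun x => ((memF x).1 x.2).2
      have mp' : ∀ x : Vᗮ, ⟪(x : E), p⟫ = 0 := fun x => by rw [real_inner_comm]; exact mp x
      have mq' : ∀ x : Vᗮ, ⟪(x : E), q⟫ = 0 := fun x => by rw [real_inner_comm]; exact mq x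
      have hqp : ⟪q, p⟫ = 0 := by rw [real_inner_comm]; exact hpq
      refine ⟨Fin.cons p (fun i => (u i : E)), Fin.cons q (fun i => (v i : E)), w,
        Fin.cons t a, ?_, ?_, ?_, ?_, ?_⟩
      · have n1 := hO.1
        have n2 := @(hO.2)
        constructor
        · rintro (i | i | i)
          · refine Fin.cases ?_ (fun i => ?_) i
            · simpa using hpn
            · simpa using n1 (.inl i)
          · refine Fin.cases ?_ (fun i => ?_) i
            · simpa using hqn
            · simpa using n1 (.inr (.inl i))
          · simpa using n1 (.inr (.inr ()))
        · rintro (i | i | i) (j | j | j) hij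
          · cases i using Fin.cases <;> cases j using Fin.cases
            · exact absurd rfl hij
            · simp [mp]
            · simp [mp']
            · rename_i i j
              have := n2 (i := .inl i) (j := .inl j) (by simpa using hij)
              simpa using this
          · cases i using Fin.cases <;> cases j using Fin.cases
            · simp [hpq]
            · simp [mp]
            · simp [mq']
            · rename_i i j
              have := n2 (i := .inl i) (j := .inr (.inl j)) (by simp)
              simpa using this
          · cases i using Fin.cases
            · simp [mp]
            · rename_i i
              have := n2 (i := .inl i) (j := .inr (.inr ())) (by simp)
              simpa using this
          · cases i using Fin.cases <;> cases j using Fin.cases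
            · simp [hqp]
            · simp [mq]
            · simp [mp']
            · rename_i i j
              have := n2 (i := .inr (.inl i)) (j := .inl j) (by simp)
              simpa using this
          · cases i using Fin.cases <;> cases j using Fin.cases
            · exact absurd rfl hij
            · simp [mq]
            · simp [mq']
            · rename_i i j
              have := n2 (i := .inr (.inl i)) (j := .inr (.inl j)) (by simpa using hij)
              simpa using this
          · cases i using Fin.cases
            · simp [mq]
            · rename_i i
              have := n2 (i := .inr (.inl i)) (j := .inr (.inr ())) (by simp)
              simpa using this
          · cases j using Fin.cases
            · simp [mp']
            · rename_i j
              have := n2 (i := .inr (.inr ())) (j := .inl j) (by simp)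
              simpa using this
          · cases j using Fin.cases
            · simp [mq']
            · rename_i j
              have := n2 (i := .inr (.inr ())) (j := .inr (.inl j)) (by simp)
              simpa using this
          · exact absurd rfl hij
      · intro i
        cases i using Fin.cases
        · simpa using ht0.le
        · simpa using ha _
      · intro i
        cases i using Fin.cases
        · simpa using hAp
        · rename_i i
          simpa using congrArg Subtype.val (hu i)
      · intro i
        cases i using Fin.cases
        · simpa using hAq
        · rename_i i
          simpa using congrArg Subtype.val (hv i)
      · simpa using congrArg Subtype.val hw

lemma trace_two {E : Type*} [NormedAddCommGroup E] [InnerProductSpace ℝ E]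
    {ι κ : Type*} [Fintype ι] [Fintype κ] (b : OrthonormalBasis ι ℝ E)
    (c : OrthonormalBasis κ ℝ E) (F : E → E → E → E → ℝ)
    (h1 : ∀ y, ∃ B : E →ₗ[ℝ] E →ₗ[ℝ] ℝ, ∀ x x', B x x' = F x x' y y)
    (h2 : ∀ x, ∃ B : E →ₗ[ℝ] E →ₗ[ℝ] ℝ, ∀ y y', B y y' = F x x y y') :
    ∑ i, ∑ j, F (b i) (b i) (b j) (b j) = ∑ i, ∑ j, F (c i) (c i) (c j) (c j) := by
  have s1 : ∀ x, ∑ j, F x x (b j) (b j) = ∑ j, F x x (c j) (c j) := by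
    intro x
    obtain ⟨B, hB⟩ := h2 x
    simpa only [hB] using trace_indep b c B
  have s2 : ∀ y, ∑ j, F (b j) (b j) y y = ∑ j, F (c j) (c j) y y := by
    intro y
    obtain ⟨B, hB⟩ := h1 y
    simpa only [hB] using trace_indep b c B
  simp_rw [s1]
  rw [Finset.sum_comm]
  simp_rw [s2]
  rw [Finset.sum_comm]

lemma core_ineq {E : Type*} [NormedAddCommGroup E] [InnerProductSpace ℝ E]
    [FiniteDimensional ℝ E] (m : ℕ) (hm : 1 ≤ m)
    (R : E →ₗ[ℝ] E →ₗ[ℝ] E →ₗ[ℝ] E →ₗ[ℝ] ℝ)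
    (hanti : ∀ X Y Z W, R X Y Z W = - R Y X Z W)
    (hpair : ∀ X Y Z W, R X Y Z W = R Z W X Y)
    (hbianchi : ∀ X Y Z W, R X Y Z W + R Y Z X W + R Z X Y W = 0)
    (hsec : ∀ X Y, 0 ≤ R X Y X Y)
    (lam : ℝ) (hlam : 2 * ((m : ℝ) - 1) / (8 * (m : ℝ) - 5) < lam)
    (hflag : ∀ e X Y : E, e ≠ 0 → ⟪e, X⟫ = 0 → ⟪e, Y⟫ = 0 →
      ‖X‖ = ‖Y‖ → lam * R e Y e Y ≤ R e X e X)
    (hne : ∃ X Y, R X Y X Y ≠ 0)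
    (u v : Fin m → E) (w : E) (a : Fin m → ℝ)
    (hO : Orthonormal ℝ (Sum.elim u (Sum.elim v (fun _ : Unit => w))))
    (ha : ∀ i, 0 ≤ a i) (ha0 : ∃ i, a i ≠ 0) :
    0 < (1 / 2) * (∑ i, a i ^ 2 * ((∑ j, (R (u i) (u j) (u i) (u j) + R (u i) (v j) (u i) (v j)
        + R (v i) (u j) (v i) (u j) + R (v i) (v j) (v i) (v j)))
        + (R (u i) w (u i) w + R (v i) w (v i) w)))
      - ∑ i, ∑ j, a i * a j * R (u i) (v i) (u j) (v j) := by
  have hm' : (1 : ℝ) ≤ m := by exact_mod_cast hm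
  rw [div_lt_iff₀ (by linarith)] at hlam
  have hl0 : 0 < lam := by nlinarith
  have self0 : ∀ X Z W, R X X Z W = 0 := fun X Z W => by linarith [hanti X X Z W]
  have symm : ∀ X Y, R X Y X Y = R Y X Y X := fun X Y => by
    rw [hanti, hpair, hanti, neg_neg]
  have nu : ∀ i, ‖u i‖ = 1 := fun i => hO.1 (.inl i)
  have nv : ∀ i, ‖v i‖ = 1 := fun i => hO.1 (.inr (.inl i))
  have nw : ‖w‖ = 1 := hO.1 (.inr (.inr ()))
  have ne0 : ∀ x : E, ‖x‖ = 1 → x ≠ 0 := by rintro x hx rfl; simp at hx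
  have uu : ∀ i j, i ≠ j → ⟪u i, u j⟫ = 0 := fun i j h =>
    hO.2 (i := .inl i) (j := .inl j) (by simpa using h)
  have vv : ∀ i j, i ≠ j → ⟪v i, v j⟫ = 0 := fun i j h =>
    hO.2 (i := .inr (.inl i)) (j := .inr (.inl j)) (by simpa using h)
  have uv : ∀ i j, ⟪u i, v j⟫ = 0 := fun i j =>
    hO.2 (i := .inl i) (j := .inr (.inl j)) (by simp)
  have vu : ∀ i j, ⟪v i, u j⟫ = 0 := fun i j =>
    hO.2 (i := .inr (.inl i)) (j := .inl j) (by simp)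
  have uw : ∀ i, ⟪u i, w⟫ = 0 := fun i =>
    hO.2 (i := .inl i) (j := .inr (.inr ())) (by simp)
  have vw : ∀ i, ⟪v i, w⟫ = 0 := fun i =>
    hO.2 (i := .inr (.inl i)) (j := .inr (.inr ())) (by simp)
  obtain ⟨K, hK⟩ : ∃ K : Fin m → ℝ, ∀ i, R (u i) (v i) (u i) (v i) = K i := ⟨_, fun i => rfl⟩
  have hK' : ∀ i, R (v i) (u i) (v i) (u i) = K i := fun i => by rw [symm]; exact hK i
  have Kpos : ∀ i, 0 < K i := fun i => by
    rw [← hK]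
    exact sec_pos R hanti hpair hsec lam hl0 hflag hne _ _ (ne0 _ (nu i)) (ne0 _ (nv i)) (uv i i)
  obtain ⟨S, hS⟩ : ∃ S : Fin m → Fin m → ℝ, ∀ i j, (R (u i) (u j) (u i) (u j)
      + R (u i) (v j) (u i) (v j)
      + R (v i) (u j) (v i) (u j) + R (v i) (v j) (v i) (v j)) = S i j := ⟨_, fun i j => rfl⟩
  obtain ⟨T, hT⟩ : ∃ T : Fin m → ℝ, ∀ i, R (u i) w (u i) w + R (v i) w (v i) w = T i :=
    ⟨_, fun i => rfl⟩
  obtain ⟨x, hx⟩ : ∃ x : Fin m → Fin m → ℝ, ∀ i j, R (u i) (v i) (u j) (v j) = x i j :=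
    ⟨_, fun i j => rfl⟩
  have hl1 : lam ≤ 1 := by
    have i0 : Fin m := ⟨0, hm⟩
    have h := hflag (u i0) (v i0) (v i0) (ne0 _ (nu i0)) (uv _ _) (uv _ _) rfl
    rw [hK] at h
    have := Kpos i0
    by_contra! hc
    nlinarith
  have Sii : ∀ i, S i i = 2 * K i := fun i => by
    rw [← hS, self0, self0, hK, hK']; ring
  have Ssymm : ∀ i j, S i j = S j i := fun i j => by
    rw [← hS, ← hS, symm (u i) (u j), symm (u i) (v j), symm (v i) (u j), symm (v i) (v j)]; ring
  have xii : ∀ i, x i i = K i := fun i => by rw [← hx, hK]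
  have Snn : ∀ i j, 0 ≤ S i j := fun i j => by
    rw [← hS]
    have := hsec (u i) (u j)
    have := hsec (u i) (v j)
    have := hsec (v i) (u j)
    have := hsec (v i) (v j)
    linarith
  have Sge : ∀ i j, i ≠ j → 4 * lam * K i ≤ S i j := fun i j hij => by
    have h1 := hflag (u i) (u j) (v i) (ne0 _ (nu i)) (uu _ _ hij) (uv _ _) (by rw [nu, nv])
    have h2 := hflag (u i) (v j) (v i) (ne0 _ (nu i)) (uv _ _) (uv _ _) (by rw [nv, nv])
    have h3 := hflag (v i) (u j) (u i) (ne0 _ (nv i)) (vu _ _) (vu _ _) (by rw [nu, nu])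
    have h4 := hflag (v i) (v j) (u i) (ne0 _ (nv i)) (vv _ _ hij) (vu _ _) (by rw [nu, nv])
    rw [hK] at h1 h2
    rw [hK'] at h3 h4
    rw [← hS]
    linarith
  have Tge : ∀ i, 2 * lam * K i ≤ T i := fun i => by
    have h1 := hflag (u i) w (v i) (ne0 _ (nu i)) (uw _) (uv _ _) (by rw [nw, nv])
    have h2 := hflag (v i) w (u i) (ne0 _ (nv i)) (vw _) (vu _ _) (by rw [nw, nu])
    rw [hK] at h1
    rw [hK'] at h2
    rw [← hT]
    linarith
  obtain ⟨κ, hκ⟩ : ∃ κ : ℝ, κ = (1 - lam) / (1 + lam) := ⟨_, rfl⟩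
  have hκ1 : κ * (1 + lam) = 1 - lam := by rw [hκ]; field_simp
  have hκ0 : 0 ≤ κ := by rw [hκ]; exact div_nonneg (by linarith) (by linarith)
  have hκle : κ ≤ 1 := by nlinarith
  have xle : ∀ i j, i ≠ j → a i * a j * x i j ≤ κ / 6 * (2 * a i ^ 2 * K i + a i ^ 2 * S i j / 2)
      + κ / 6 * (2 * a j ^ 2 * K j + a j ^ 2 * S j i / 2) := fun i j hij => by
    have h := mix_bound R hanti hpair hbianchi lam hflag (u i) (v i) (u j) (v j)
      (uv _ _) (uu _ _ hij) (uv _ _) (vu _ _) (vv _ _ hij) (uv _ _) (a i) (a j) (ha i) (ha j)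
    rw [hS, hK, hK, hx, ← hκ1] at h
    have h' : 6 * (a i * a j * x i j) ≤ κ * (2 * a i ^ 2 * K i + 2 * a j ^ 2 * K j
        + a i * a j * S i j) := by
      have hp : 0 < 1 + lam := by linarith
      refine le_of_mul_le_mul_left ?_ hp
      linarith
    have h2 : a i * a j * S i j ≤ (a i ^ 2 + a j ^ 2) / 2 * S i j :=
      mul_le_mul_of_nonneg_right (by nlinarith [sq_nonneg (a i - a j)]) (Snn i j)
    have h3 := mul_le_mul_of_nonneg_left h2 hκ0
    rw [Ssymm j i]
    linarith
  simp_rw [hS, hT, hx]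
  let f : Fin m → Fin m → ℝ := fun i j => if i = j then a i ^ 2 * K i / 2 else
    κ / 6 * (2 * a i ^ 2 * K i + a i ^ 2 * S i j / 2)
  have hf : ∀ i j, a i * a j * x i j ≤ f i j + f j i := fun i j => by
    by_cases hij : i = j
    · subst hij
      simp only [f, if_true, xii]
      exact le_of_eq (by ring)
    · simp only [f, if_neg hij, if_neg (Ne.symm hij)]
      exact xle i j hij
  have hg : ∀ i j, (if i = j then 0 else a i ^ 2 * K i * ((2 / 3) * (4 * lam - 1))) ≤
      1 / 2 * (a i ^ 2 * S i j) - 2 * f i j := fun i j => by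
    by_cases hij : i = j
    · subst hij
      simp only [f, if_true, Sii]
      exact le_of_eq (by ring)
    · simp only [f, if_neg hij]
      have h1 := Sge i j hij
      have h2 : (1 / 2 - κ / 6) * (4 * lam * K i) ≤ (1 / 2 - κ / 6) * S i j :=
        mul_le_mul_of_nonneg_left h1 (by linarith)
      have h3 := mul_le_mul_of_nonneg_left h2 (sq_nonneg (a i))
      have h4 : a i ^ 2 * K i * (κ * (1 + lam)) = a i ^ 2 * K i * (1 - lam) := by rw [hκ1]
      linarith
  have hsum : ∑ i, ∑ j, a i * a j * x i j ≤ 2 * ∑ i, ∑ j, f i j := by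
    calc _ ≤ ∑ i, ∑ j, (f i j + f j i) :=
          Finset.sum_le_sum fun i _ => Finset.sum_le_sum fun j _ => hf i j
      _ = _ := by
          simp_rw [Finset.sum_add_distrib]
          rw [Finset.sum_comm (f := fun i j => f j i)]; ring
  have hrow : ∀ i, a i ^ 2 * K i * (((m : ℝ) - 1) * ((2 / 3) * (4 * lam - 1)) + lam) ≤
      1 / 2 * (a i ^ 2 * (∑ j, S i j + T i)) - 2 * ∑ j, f i j := by
    intro i
    have h := Finset.sum_le_sum fun j (_ : j ∈ Finset.univ) => hg i j
    rw [Finset.sum_sub_distrib, ← Finset.mul_sum, ← Finset.mul_sum, ← Finset.mul_sum] at h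
    have h5 : ∑ j, (if i = j then 0 else a i ^ 2 * K i * ((2 / 3) * (4 * lam - 1))) =
        ((m : ℝ) - 1) * (a i ^ 2 * K i * ((2 / 3) * (4 * lam - 1))) := by
      have : ∀ j, (if i = j then 0 else a i ^ 2 * K i * ((2 / 3) * (4 * lam - 1))) =
        a i ^ 2 * K i * ((2 / 3) * (4 * lam - 1)) -
          (if i = j then a i ^ 2 * K i * ((2 / 3) * (4 * lam - 1)) else 0) := by
        intro j; split_ifs <;> simp
      simp_rw [this]
      rw [Finset.sum_sub_distrib, Finset.sum_ite_eq]
      simp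
      ring
    rw [h5] at h
    have h6 := mul_le_mul_of_nonneg_left (Tge i) (sq_nonneg (a i))
    linarith
  have hc : 0 < ((m : ℝ) - 1) * ((2 / 3) * (4 * lam - 1)) + lam := by nlinarith
  have hpos : 0 < ∑ i, a i ^ 2 * K i * (((m : ℝ) - 1) * ((2 / 3) * (4 * lam - 1)) + lam) := by
    obtain ⟨i, hi⟩ := ha0
    refine Finset.sum_pos' (fun i _ => ?_) ⟨i, Finset.mem_univ _, ?_⟩
    · have := (Kpos i).le
      positivity
    · have := Kpos i
      positivity
  have hfin := Finset.sum_le_sum fun i (_ : i ∈ Finset.univ) => hrow i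
  rw [Finset.sum_sub_distrib, ← Finset.mul_sum, ← Finset.mul_sum] at hfin
  linarith

theorem stmt_17 (n m : ℕ) (hm : 1 ≤ m) (hnm : n = 2 * m + 1)
    (R : EuclideanSpace ℝ (Fin n) →ₗ[ℝ] EuclideanSpace ℝ (Fin n) →ₗ[ℝ]
      EuclideanSpace ℝ (Fin n) →ₗ[ℝ] EuclideanSpace ℝ (Fin n) →ₗ[ℝ] ℝ)
    (hanti : ∀ X Y Z W, R X Y Z W = - R Y X Z W)
    (hpair : ∀ X Y Z W, R X Y Z W = R Z W X Y)
    (hbianchi : ∀ X Y Z W, R X Y Z W + R Y Z X W + R Z X Y W = 0)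
    (hsec : ∀ X Y, 0 ≤ R X Y X Y)
    (lam : ℝ) (hlam : 2 * ((m : ℝ) - 1) / (8 * (m : ℝ) - 5) < lam)
    (hflag : ∀ e X Y : EuclideanSpace ℝ (Fin n), e ≠ 0 → ⟪e, X⟫ = 0 → ⟪e, Y⟫ = 0 →
      ‖X‖ = ‖Y‖ → lam * R e Y e Y ≤ R e X e X)
    -- the components of `R` in the standard orthonormal basis
    (R4 : Fin n → Fin n → Fin n → Fin n → ℝ)
    (hR4 : ∀ i j k l, R4 i j k l =
      R (EuclideanSpace.single i 1) (EuclideanSpace.single j 1)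
        (EuclideanSpace.single k 1) (EuclideanSpace.single l 1))
    -- positive scalar curvature
    (hscal : 0 < ∑ i, ∑ j, R4 i j i j)
    (Ω : Fin n → Fin n → ℝ) (hΩanti : ∀ a b, Ω a b = - Ω b a) (hΩ : Ω ≠ 0) :
    0 < soInner (fun a b => ricWedgeId R4 Ω a b - rmOp R4 Ω a b) Ω := by
  obtain ⟨e, he⟩ : ∃ e : OrthonormalBasis (Fin n) ℝ (EuclideanSpace ℝ (Fin n)),
      ∀ i, e i = EuclideanSpace.single i 1 := ⟨EuclideanSpace.basisFun _ _, by simp⟩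
  simp_rw [← he] at hR4
  let A : EuclideanSpace ℝ (Fin n) →ₗ[ℝ] EuclideanSpace ℝ (Fin n) :=
    e.toBasis.constr ℝ (fun i => ∑ j, Ω i j • e j)
  have hAe : ∀ i, A (e i) = ∑ j, Ω i j • e j := fun i => by
    have := e.toBasis.constr_basis ℝ (fun i => ∑ j, Ω i j • e j) i
    simpa [A] using this
  have hon : ∀ i j, ⟪e i, e j⟫ = if i = j then 1 else 0 := orthonormal_iff_ite.1 e.orthonormal
  have hAij : ∀ i j, ⟪A (e i), e j⟫ = Ω i j := fun i j => by
    rw [hAe, sum_inner]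
    simp [inner_smul_left, hon]
  have hA : ∀ x y, ⟪A x, y⟫ = - ⟪x, A y⟫ := by
    have h : (innerₗ (EuclideanSpace ℝ (Fin n))).comp A
        = -((innerₗ (EuclideanSpace ℝ (Fin n))).compl₂ A) := by
      refine e.toBasis.ext fun i => e.toBasis.ext fun j => ?_
      simp only [OrthonormalBasis.coe_toBasis, LinearMap.comp_apply, LinearMap.neg_apply,
        LinearMap.compl₂_apply, innerₗ_apply_apply]
      rw [hAij, real_inner_comm, hAij, hΩanti]
    intro x y
    have := LinearMap.congr_fun (LinearMap.congr_fun h x) y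
    simpa using this
  obtain ⟨u, v, w, a, hO, ha, hu, hv, hw⟩ := normal_form m _ (by simp [hnm]) A hA
  have hcard : Fintype.card (Fin m ⊕ Fin m ⊕ Unit) = Module.finrank ℝ (EuclideanSpace ℝ (Fin n)) := by
    simp [hnm]; omega
  obtain ⟨c, hc⟩ : ∃ c : OrthonormalBasis (Fin m ⊕ Fin m ⊕ Unit) ℝ (EuclideanSpace ℝ (Fin n)),
      ⇑c = Sum.elim u (Sum.elim v (fun _ : Unit => w)) := by
    exact ⟨OrthonormalBasis.mk hO (by
      rw [hO.linearIndependent.span_eq_top_of_card_eq_finrank' hcard]), by simp⟩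
  have hne : ∃ X Y, R X Y X Y ≠ 0 := by
    by_contra! h
    simp [hR4, h] at hscal
  have ha0 : ∃ i, a i ≠ 0 := by
    by_contra! h
    have hA0 : A = 0 := c.toBasis.ext fun i => by
      rw [OrthonormalBasis.coe_toBasis, hc]
      rcases i with i | i | i
      · simp [hu, h]
      · simp [hv, h]
      · simpa using hw
    apply hΩ
    ext i j
    rw [← hAij, hA0]; simp
  have hcore := core_ineq m hm R hanti hpair hbianchi hsec lam hlam hflag hne u v w a hO ha ha0
  have t1 := trace_two e c (fun x x' y y' => R (A x) y (A x') y')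
    (fun y => ⟨LinearMap.mk₂ ℝ (fun x x' => R (A x) y (A x') y) (by simp) (by simp) (by simp)
      (by simp), fun _ _ => rfl⟩)
    (fun x => ⟨LinearMap.mk₂ ℝ (fun y y' => R (A x) y (A x) y') (by simp) (by simp) (by simp)
      (by simp), fun _ _ => rfl⟩)
  have t2 := trace_two e c (fun x x' y y' => R x (A x') y (A y'))
    (fun y => ⟨LinearMap.mk₂ ℝ (fun x x' => R x (A x') y (A y)) (by simp) (by simp) (by simp)
      (by simp), fun _ _ => rfl⟩)
    (fun x => ⟨LinearMap.mk₂ ℝ (fun y y' => R x (A x) y (A y')) (by simp) (by simp) (by simp)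
      (by simp), fun _ _ => rfl⟩)
  have hD : soInner (fun a b => ricWedgeId R4 Ω a b - rmOp R4 Ω a b) Ω =
      (1 / 2) * (∑ i, ∑ j, R (A (e i)) (e j) (A (e i)) (e j))
      - (1 / 4) * ∑ i, ∑ j, R (e i) (A (e i)) (e j) (A (e j)) := by
    have q1 : ∀ i j, R (A (e i)) (e j) (A (e i)) (e j) =
        ∑ p, ∑ q, Ω i p * Ω i q * R4 p j q j := by
      intro i j
      simp only [hAe, map_sum, LinearMap.sum_apply, map_smul, LinearMap.smul_apply, smul_eq_mul,
        ← hR4, Finset.mul_sum]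
      rw [Finset.sum_comm]
      refine Finset.sum_congr rfl fun p _ => Finset.sum_congr rfl fun q _ => ?_
      ring
    have p1 : ∑ i, ∑ j, R (A (e i)) (e j) (A (e i)) (e j) =
        ∑ i, ∑ p, ∑ q, Ω i p * Ω i q * ∑ j, R4 p j q j := by
      refine Finset.sum_congr rfl fun i _ => ?_
      simp_rw [q1, Finset.mul_sum]
      rw [Finset.sum_comm]
      refine Finset.sum_congr rfl fun p _ => ?_
      rw [Finset.sum_comm]
    have q2 : ∀ i j, R (e i) (A (e i)) (e j) (A (e j)) =
        ∑ p, ∑ q, R4 i p j q * Ω i p * Ω j q := by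
      intro i j
      simp only [hAe, map_sum, LinearMap.sum_apply, map_smul, LinearMap.smul_apply, smul_eq_mul,
        ← hR4, Finset.mul_sum]
      rw [Finset.sum_comm]
      refine Finset.sum_congr rfl fun p _ => Finset.sum_congr rfl fun q _ => ?_
      ring
    have p2 : ∑ i, ∑ j, R (e i) (A (e i)) (e j) (A (e j)) =
        ∑ k, ∑ l, ∑ i, ∑ j, R4 i j k l * Ω i j * Ω k l := by
      simp_rw [q2]
      rw [Finset.sum_comm]
      refine Finset.sum_congr rfl fun k _ => ?_
      simp_rw [Finset.sum_comm (γ := Fin n) (f := fun p q => R4 _ p k q * Ω _ p * Ω k q)]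
      rw [Finset.sum_comm]
    have r1 : ∑ a, ∑ b, (∑ k, (∑ i, R4 a i k i) * Ω k b) * Ω a b =
        ∑ i, ∑ p, ∑ q, Ω i p * Ω i q * ∑ j, R4 p j q j := by
      rw [Finset.sum_comm]
      refine Finset.sum_congr rfl fun b _ => Finset.sum_congr rfl fun a _ => ?_
      rw [Finset.sum_mul]
      refine Finset.sum_congr rfl fun k _ => ?_
      rw [hΩanti k b, hΩanti a b]; ring
    have r2 : ∑ a, ∑ b, (∑ k, Ω a k * (∑ i, R4 k i b i)) * Ω a b =
        ∑ i, ∑ p, ∑ q, Ω i p * Ω i q * ∑ j, R4 p j q j := by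
      refine Finset.sum_congr rfl fun a _ => ?_
      rw [Finset.sum_comm]
      refine Finset.sum_congr rfl fun b _ => ?_
      rw [Finset.sum_mul]
      refine Finset.sum_congr rfl fun k _ => ?_
      ring
    have r3 : ∑ k, ∑ l, (∑ i, ∑ j, R4 i j k l * Ω i j) * Ω k l =
        ∑ k, ∑ l, ∑ i, ∑ j, R4 i j k l * Ω i j * Ω k l := by
      simp_rw [Finset.sum_mul]
    rw [p1, p2, ← r3]
    have r12 : ∑ i, ∑ p, ∑ q, Ω i p * Ω i q * ∑ j, R4 p j q j = (1 / 2) *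
        (∑ a, ∑ b, (∑ k, (∑ i, R4 a i k i) * Ω k b) * Ω a b
          + ∑ a, ∑ b, (∑ k, Ω a k * (∑ i, R4 k i b i)) * Ω a b) := by
      rw [r1, r2]; ring
    rw [r12]
    unfold soInner ricWedgeId rmOp
    simp only [Finset.sum_add_distrib, sub_mul, add_mul, mul_add, mul_assoc,
      Finset.sum_sub_distrib, ← Finset.mul_sum]
    ring
  have hv' : ∀ i, A (v i) = (-a i) • u i := fun i => by rw [hv, neg_smul]
  have G1 : ∑ i, ∑ j, R (A (c i)) (c j) (A (c i)) (c j) =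
      ∑ i, a i ^ 2 * ((∑ j, (R (u i) (u j) (u i) (u j) + R (u i) (v j) (u i) (v j)
        + R (v i) (u j) (v i) (u j) + R (v i) (v j) (v i) (v j)))
        + (R (u i) w (u i) w + R (v i) w (v i) w)) := by
    rw [hc]
    simp only [Fintype.sum_sum_type, Sum.elim_inl, Sum.elim_inr, hu, hv', hw, map_smul,
      LinearMap.smul_apply, smul_eq_mul, map_zero, LinearMap.zero_apply,
      Finset.sum_const_zero, add_zero, Finset.univ_unique, Finset.sum_singleton]
    rw [← Finset.sum_add_distrib]
    refine Finset.sum_congr rfl fun i _ => ?_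
    simp only [Finset.sum_add_distrib, ← Finset.mul_sum]
    ring
  have G2 : ∑ i, ∑ j, R (c i) (A (c i)) (c j) (A (c j)) =
      4 * ∑ i, ∑ j, a i * a j * R (u i) (v i) (u j) (v j) := by
    have w1 : ∀ (j : Fin m) (X Y : EuclideanSpace ℝ (Fin n)),
        R X Y (v j) (u j) = - R X Y (u j) (v j) := fun j X Y => by
      rw [hpair, hanti, hpair]
    have w2 : ∀ (j : Fin m) (X Y : EuclideanSpace ℝ (Fin n)),
        R (v j) (u j) X Y = - R (u j) (v j) X Y := fun j X Y => by
      rw [hanti]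
    rw [hc]
    simp only [Fintype.sum_sum_type, Sum.elim_inl, Sum.elim_inr, hu, hv', hw, map_smul,
      LinearMap.smul_apply, smul_eq_mul, map_zero, LinearMap.zero_apply,
      Finset.sum_const_zero, add_zero, neg_neg, mul_neg, neg_mul, mul_zero, w1, w2]
    rw [← Finset.sum_add_distrib, Finset.mul_sum]
    refine Finset.sum_congr rfl fun i _ => ?_
    rw [← Finset.sum_add_distrib, ← Finset.sum_add_distrib, Finset.mul_sum]
    refine Finset.sum_congr rfl fun j _ => ?_
    ring
  rw [hD, t1, t2, G1, G2]
  linarith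
end
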